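/- Let G be an s-bridgeless signed graph with negativeness ε_N(G) > 0 and edge set E. Then SCC(G) ≤ (14/3)|E| − (5/3)ε_N(G) − 4. -/

import Mathlib

open scoped Classical

noncomputable section

/-- A signed (multi)graph: a finite multigraph (loops and multiple edges allowed)
together with a sign on each edge (`neg e = true` means `e` is negative). -/
structure SignedMultigraph where
  V : Type
  E : Type
  [fintypeV : Fintype V]
  [fintypeE : Fintype E]
  ends : E → Sym2 V
  neg : E → Bool

attribute [instance] SignedMultigraph.fintypeV SignedMultigraph.fintypeE

namespace SignedMultigraph

variable (G : SignedMultigraph)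

/-- The vertices incident with at least one edge of `S`. -/
def support (S : Finset G.E) : Finset G.V :=
  Finset.univ.filter fun v => ∃ e ∈ S, v ∈ G.ends e

/-- Degree of `v` in the edge set `S`; loops count twice. -/
def degIn (S : Finset G.E) (v : G.V) : ℕ :=
  ∑ e ∈ S, (if G.ends e = Sym2.diag v then 2 else if v ∈ G.ends e then 1 else 0)

/-- `u` and `v` are joined by an edge of `S`. -/
def Adj (S : Finset G.E) (u v : G.V) : Prop := ∃ e ∈ S, G.ends e = s(u, v)

/-- Reachability using only edges of `S`. -/
def Reach (S : Finset G.E) : G.V → G.V → Prop := Relation.ReflTransGen (G.Adj S)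

/-- The subgraph with edge set `S` (and vertex set its support) is connected. -/
def ConnOn (S : Finset G.E) : Prop :=
  ∀ u ∈ G.support S, ∀ v ∈ G.support S, G.Reach S u v

/-- The whole signed graph is connected. -/
def Connected : Prop := Nonempty G.V ∧ ∀ u v : G.V, G.Reach Finset.univ u v

/-- The negative edges among `S`. -/
def negEdges (S : Finset G.E) : Finset G.E := S.filter fun e => G.neg e = true

/-- A circuit: a (nonempty) connected 2-regular subgraph, given by its edge set. -/
def IsCircuit (S : Finset G.E) : Prop :=
  S.Nonempty ∧ G.ConnOn S ∧ ∀ v ∈ G.support S, G.degIn S v = 2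

/-- A balanced circuit: a circuit with an even number of negative edges. -/
def IsBalancedCircuit (S : Finset G.E) : Prop :=
  G.IsCircuit S ∧ Even (G.negEdges S).card

/-- An unbalanced circuit: a circuit with an odd number of negative edges. -/
def IsUnbalancedCircuit (S : Finset G.E) : Prop :=
  G.IsCircuit S ∧ ¬ Even (G.negEdges S).card

/-- A short barbell: two unbalanced circuits meeting at exactly one vertex. -/
def IsShortBarbell (S : Finset G.E) : Prop :=
  ∃ C₁ C₂ : Finset G.E, G.IsUnbalancedCircuit C₁ ∧ G.IsUnbalancedCircuit C₂ ∧
    Disjoint C₁ C₂ ∧ (G.support C₁ ∩ G.support C₂).card = 1 ∧ S = C₁ ∪ C₂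

/-- A path with (distinct) ends `u` and `v`, given by its edge set. -/
def IsPath (P : Finset G.E) (u v : G.V) : Prop :=
  P.Nonempty ∧ G.ConnOn P ∧ u ≠ v ∧ u ∈ G.support P ∧ v ∈ G.support P ∧
    G.degIn P u = 1 ∧ G.degIn P v = 1 ∧
    ∀ w ∈ G.support P, w ≠ u → w ≠ v → G.degIn P w = 2

/-- A long barbell: two vertex-disjoint unbalanced circuits joined by a path
meeting the circuits only at its ends. -/
def IsLongBarbell (S : Finset G.E) : Prop :=
  ∃ (C₁ C₂ P : Finset G.E) (u v : G.V),
    G.IsUnbalancedCircuit C₁ ∧ G.IsUnbalancedCircuit C₂ ∧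
    Disjoint (G.support C₁) (G.support C₂) ∧
    G.IsPath P u v ∧
    G.support P ∩ G.support C₁ = {u} ∧ G.support P ∩ G.support C₂ = {v} ∧
    Disjoint P C₁ ∧ Disjoint P C₂ ∧
    S = C₁ ∪ C₂ ∪ P

/-- A signed circuit: a balanced circuit, a short barbell, or a long barbell. -/
def IsSignedCircuit (S : Finset G.E) : Prop :=
  G.IsBalancedCircuit S ∨ G.IsShortBarbell S ∨ G.IsLongBarbell S

/-- The number of members of the family `F` containing the edge `e`. -/
def coverCount (F : Multiset (Finset G.E)) (e : G.E) : ℕ :=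
  (F.filter fun S => e ∈ S).card

/-- The total length of the family `F`. -/
def coverLength (F : Multiset (Finset G.E)) : ℕ := (F.map Finset.card).sum

/-- A signed circuit cover: every edge is in at least one member. -/
def IsSignedCircuitCover (F : Multiset (Finset G.E)) : Prop :=
  (∀ S ∈ F, G.IsSignedCircuit S) ∧ ∀ e : G.E, 1 ≤ G.coverCount F e

/-- The length of a shortest signed circuit cover. -/
def SCC : ℕ := sInf { n | ∃ F, G.IsSignedCircuitCover F ∧ G.coverLength F = n }

/-- Whether edge `e` has exactly one endpoint in the vertex set `A`. -/
def crossesB (A : Finset G.V) (e : G.E) : Bool :=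
  Sym2.lift ⟨fun x y => Bool.xor (decide (x ∈ A)) (decide (y ∈ A)),
    fun x y => Bool.xor_comm _ _⟩ (G.ends e)

/-- Sign of `e` (`true` = negative) after switching at every vertex of `A`. -/
def negAfter (A : Finset G.V) (e : G.E) : Bool :=
  Bool.xor (G.neg e) (G.crossesB A e)

/-- Minimum number of negative edges in `S` over all switchings. -/
def negOf (S : Finset G.E) : ℕ :=
  sInf { n | ∃ A : Finset G.V, (S.filter fun e => G.negAfter A e = true).card = n }

/-- The negativeness of `G`. -/
def negativeness : ℕ := G.negOf Finset.univ

/-- The edges of `S` with exactly one endpoint in `U`: the edge boundary `δ(U)` inside `S`. -/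
def boundary (S : Finset G.E) (U : Finset G.V) : Finset G.E :=
  S.filter fun e => G.crossesB U e = true

/-- `b` is a bridge of the subgraph with edge set `S`. -/
def IsBridge (S : Finset G.E) (b : G.E) : Prop :=
  ∃ U : Finset G.V, G.boundary S U = {b}

/-- The subgraph with edge set `S` is bridgeless. -/
def Bridgeless (S : Finset G.E) : Prop := ∀ b ∈ S, ¬ G.IsBridge S b

/-- `G` is 2-edge-connected. -/
def TwoEdgeConnected : Prop :=
  G.Connected ∧ ∀ b : G.E, ¬ G.IsBridge Finset.univ b

/-- Edges of `S` lying in the same component (of the subgraph with edge set `S`)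
as the vertex `x`. -/
def compEdges (S : Finset G.E) (x : G.V) : Finset G.E :=
  S.filter fun e => ∃ u, u ∈ G.ends e ∧ G.Reach S x u

/-- A g-bridge: a bridge such that both components of `G - b` have even negativeness. -/
def IsGBridge (b : G.E) : Prop :=
  G.IsBridge Finset.univ b ∧
    ∃ x y : G.V, G.ends b = s(x, y) ∧
      Even (G.negOf (G.compEdges (Finset.univ.erase b) x)) ∧
      Even (G.negOf (G.compEdges (Finset.univ.erase b) y))

/-- `G` has no g-bridge (in any of its components). -/
def GBridgeless : Prop := ∀ b : G.E, ¬ G.IsGBridge b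

/-- Member of `B_g(G)`: a bridge such that at least one component of `G - b`
contains an odd number of negative edges. -/
def IsBgBridge (b : G.E) : Prop :=
  G.IsBridge Finset.univ b ∧
    ∃ x : G.V, x ∈ G.ends b ∧
      ¬ Even (G.negEdges (G.compEdges (Finset.univ.erase b) x)).card

/-- Member of `B_s(G)`: a bridge such that each of the two components of `G - b`
contains a negative edge. -/
def IsSBridge (b : G.E) : Prop :=
  G.IsBridge Finset.univ b ∧
    ∃ x y : G.V, G.ends b = s(x, y) ∧
      (G.negEdges (G.compEdges (Finset.univ.erase b) x)).Nonempty ∧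
      (G.negEdges (G.compEdges (Finset.univ.erase b) y)).Nonempty

/-- `G` is s-bridgeless: every edge lies in some signed circuit. -/
def SBridgeless : Prop := ∀ e : G.E, ∃ S : Finset G.E, G.IsSignedCircuit S ∧ e ∈ S

/-- `{e, f}` is a 2-edge-cut of `G`. -/
def IsTwoEdgeCut (e f : G.E) : Prop :=
  e ≠ f ∧ ∃ U : Finset G.V, G.boundary Finset.univ U = {e, f}

/-- `S_G(e) = {e} ∪ {f : {e,f} is a 2-edge-cut of G}`. -/
def SSet (e : G.E) : Finset G.E :=
  insert e (Finset.univ.filter fun f => G.IsTwoEdgeCut e f)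

/-- The edge set `R` spans an acyclic subgraph (every nonempty subset has a
vertex of degree one). -/
def AcyclicSet (R : Finset G.E) : Prop :=
  ∀ F ⊆ R, F.Nonempty → ∃ v : G.V, G.degIn F v = 1

/-- `T` is the edge set of a spanning tree of `G`. -/
def IsSpanningTree (T : Finset G.E) : Prop :=
  G.AcyclicSet T ∧ Nonempty G.V ∧ ∀ u v : G.V, G.Reach T u v

/-- `G` is eulerian: connected with all degrees even. -/
def Eulerian : Prop :=
  G.Connected ∧ ∀ v : G.V, Even (G.degIn Finset.univ v)

/-- The edge set `S` spans an eulerian subgraph. -/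
def IsEulerianSub (S : Finset G.E) : Prop :=
  S.Nonempty ∧ G.ConnOn S ∧ ∀ v ∈ G.support S, Even (G.degIn S v)

/-- The vertex class of `v` after contracting each member of `ℬ`. -/
def classOf (ℬ : Finset (Finset G.E)) (v : G.V) : Finset G.V :=
  Finset.univ.filter fun u => u = v ∨ ∃ B ∈ ℬ, v ∈ G.support B ∧ u ∈ G.support B

/-- Degree, in edge set `F`, of the contracted class of `v`. -/
def classDeg (ℬ : Finset (Finset G.E)) (F : Finset G.E) (v : G.V) : ℕ :=
  ∑ u ∈ G.classOf ℬ v, G.degIn F u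

/-- `ℬ` witnesses that the subgraph with edge set `S` is a generalized barbell:
`ℬ` is a family of vertex-disjoint eulerian subgraphs of `S`, the contraction
`S/(∪ℬ)` is acyclic, and for every vertex `x` of the contracted graph,
`|E_N(B_x)| ≡ |δ(V(B_x))| (mod 2)`. -/
def GenBarbellWitness (S : Finset G.E) (ℬ : Finset (Finset G.E)) : Prop :=
  (∀ B ∈ ℬ, B ⊆ S ∧ G.IsEulerianSub B) ∧
  (∀ B₁ ∈ ℬ, ∀ B₂ ∈ ℬ, B₁ ≠ B₂ → Disjoint (G.support B₁) (G.support B₂)) ∧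
  (∀ F ⊆ S \ ℬ.sup id, F.Nonempty → ∃ v : G.V, G.classDeg ℬ F v = 1) ∧
  (∀ B ∈ ℬ, (G.negEdges B).card ≡ (G.boundary S (G.support B)).card [MOD 2]) ∧
  (∀ v ∈ G.support S, (∀ B ∈ ℬ, v ∉ G.support B) → Even (G.boundary S {v}).card)

/-- The subgraph with edge set `S` is a generalized barbell. -/
def IsGenBarbell (S : Finset G.E) : Prop := ∃ ℬ, G.GenBarbellWitness S ℬ

end SignedMultigraph

namespace SignedMultigraph

open scoped symmDiff

variable {G : SignedMultigraph}

/-- The degree vector of an edge set modulo two. -/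
def par (S : Finset G.E) : G.V → ZMod 2 := fun v => (G.degIn S v : ZMod 2)

/-- The edges of `S` with all ends in `A`. -/
def within (S : Finset G.E) (A : Finset G.V) : Finset G.E :=
  S.filter fun e => ∀ u ∈ G.ends e, u ∈ A

/-- The vertices reachable from `x` using edges of `S`. -/
def comp (S : Finset G.E) (x : G.V) : Finset G.V :=
  Finset.univ.filter fun v => G.Reach S x v

lemma exists_ends (e : G.E) : ∃ a b, G.ends e = s(a, b) := by
  induction h : G.ends e with | _ a b => exact ⟨a, b, rfl⟩

lemma mult_eq {e : G.E} {a b : G.V} (h : G.ends e = s(a, b)) (v : G.V) :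
    (if G.ends e = Sym2.diag v then 2 else if v ∈ G.ends e then 1 else 0 : ℕ) =
      (if a = v then 1 else 0) + (if b = v then 1 else 0) := by
  rw [h, Sym2.diag]
  by_cases h1 : a = v <;> by_cases h2 : b = v <;> simp [h1, h2, eq_comm]

lemma degIn_union {S T : Finset G.E} (h : Disjoint S T) (v : G.V) :
    G.degIn (S ∪ T) v = G.degIn S v + G.degIn T v := Finset.sum_union h

lemma degIn_mono {S T : Finset G.E} (h : S ⊆ T) (v : G.V) : G.degIn S v ≤ G.degIn T v :=
  Finset.sum_le_sum_of_subset h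

lemma mem_support {S : Finset G.E} {v : G.V} : v ∈ G.support S ↔ ∃ e ∈ S, v ∈ G.ends e := by
  simp [support]

lemma support_mono {S T : Finset G.E} (h : S ⊆ T) : G.support S ⊆ G.support T := by
  intro v hv
  obtain ⟨e, he, hv⟩ := mem_support.1 hv
  exact mem_support.2 ⟨e, h he, hv⟩

lemma support_union (S T : Finset G.E) : G.support (S ∪ T) = G.support S ∪ G.support T := by
  ext v
  simp only [mem_support, Finset.mem_union]
  grind

lemma degIn_eq_zero_iff {S : Finset G.E} {v : G.V} : G.degIn S v = 0 ↔ v ∉ G.support S := by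
  rw [degIn, Finset.sum_eq_zero_iff, mem_support]
  push Not
  refine forall₂_congr fun e _ => ?_
  obtain ⟨a, b, h⟩ := exists_ends e
  rw [mult_eq h, h, Sym2.mem_iff]
  by_cases h1 : a = v <;> by_cases h2 : b = v <;> simp [h1, h2, eq_comm]
  tauto

lemma degIn_singleton {e : G.E} {a b : G.V} (h : G.ends e = s(a, b)) (v : G.V) :
    G.degIn {e} v = (if a = v then 1 else 0) + (if b = v then 1 else 0) := by
  rw [degIn, Finset.sum_singleton, mult_eq h]

lemma sum_symmDiff_zmod {α : Type*} (S T : Finset α) (f : α → ZMod 2) :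
    ∑ e ∈ S ∆ T, f e = ∑ e ∈ S, f e + ∑ e ∈ T, f e := by
  have h1 : ∑ e ∈ S, f e = ∑ e ∈ S \ T, f e + ∑ e ∈ S ∩ T, f e := by
    rw [add_comm, Finset.sum_inter_add_sum_sdiff]
  have h2 : ∑ e ∈ T, f e = ∑ e ∈ T \ S, f e + ∑ e ∈ S ∩ T, f e := by
    rw [add_comm, Finset.inter_comm, Finset.sum_inter_add_sum_sdiff]
  rw [h1, h2, symmDiff_def, Finset.sup_eq_union, Finset.sum_union disjoint_sdiff_sdiff]
  have := CharTwo.add_self_eq_zero (∑ e ∈ S ∩ T, f e)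
  linear_combination -this

lemma vec_add_self {α : Type*} (f : α → ZMod 2) : f + f = 0 := by
  funext v; exact CharTwo.add_self_eq_zero _

lemma par_symmDiff (S T : Finset G.E) : par (S ∆ T) = par S + par T := by
  funext v
  simp only [par, degIn, Pi.add_apply, Nat.cast_sum]
  exact sum_symmDiff_zmod _ _ _

@[simp] lemma par_empty : par (∅ : Finset G.E) = 0 := by
  funext v; simp [par, degIn]

lemma par_union {S T : Finset G.E} (h : Disjoint S T) : par (S ∪ T) = par S + par T := by
  rw [← par_symmDiff, h.symmDiff_eq_sup]; rfl

lemma symmDiff_eq_sdiff {α : Type*} {S T : Finset α} (h : T ⊆ S) : S ∆ T = S \ T := by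
  ext x; simp only [Finset.mem_symmDiff, Finset.mem_sdiff]; constructor
  · rintro (h1 | h1)
    · exact h1
    · exact absurd (h h1.1) h1.2
  · exact Or.inl

lemma par_sdiff {S T : Finset G.E} (h : T ⊆ S) : par (S \ T) = par S + par T := by
  rw [← par_symmDiff, symmDiff_eq_sdiff h]

lemma par_singleton {e : G.E} {a b : G.V} (h : G.ends e = s(a, b)) :
    par {e} = Pi.single a 1 + Pi.single b 1 := by
  funext v
  rw [par, degIn_singleton h]
  simp only [Pi.add_apply, Pi.single_apply, eq_comm (a := v)]
  push_cast
  rfl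

lemma crossesB_eq {e : G.E} {a b : G.V} (h : G.ends e = s(a, b)) (A : Finset G.V) :
    G.crossesB A e = Bool.xor (decide (a ∈ A)) (decide (b ∈ A)) := by
  rw [crossesB, h]; rfl

lemma mem_boundary {S : Finset G.E} {A : Finset G.V} {e : G.E} {a b : G.V}
    (h : G.ends e = s(a, b)) : e ∈ G.boundary S A ↔ e ∈ S ∧ ¬ (a ∈ A ↔ b ∈ A) := by
  rw [boundary, Finset.mem_filter, crossesB_eq h]
  by_cases h1 : a ∈ A <;> by_cases h2 : b ∈ A <;> simp [h1, h2]

lemma mem_within {S : Finset G.E} {A : Finset G.V} {e : G.E} {a b : G.V}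
    (h : G.ends e = s(a, b)) : e ∈ within S A ↔ e ∈ S ∧ a ∈ A ∧ b ∈ A := by
  rw [within, Finset.mem_filter, h]; simp

lemma boundary_subset (S : Finset G.E) (A : Finset G.V) : G.boundary S A ⊆ S :=
  Finset.filter_subset _ _

lemma within_subset (S : Finset G.E) (A : Finset G.V) : within S A ⊆ S :=
  Finset.filter_subset _ _

lemma boundary_mono {S T : Finset G.E} (h : S ⊆ T) (A : Finset G.V) :
    G.boundary S A ⊆ G.boundary T A := Finset.filter_subset_filter _ h

lemma mem_boundary_of_subset {S T : Finset G.E} {A : Finset G.V} {e : G.E}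
    (he : e ∈ G.boundary T A) (h : e ∈ S) : e ∈ G.boundary S A :=
  Finset.mem_filter.2 ⟨h, (Finset.mem_filter.1 he).2⟩

lemma sum_par (S : Finset G.E) (A : Finset G.V) :
    ∑ v ∈ A, par S v = ((G.boundary S A).card : ZMod 2) := by
  simp only [par, degIn, Nat.cast_sum]
  rw [Finset.sum_comm, boundary, Finset.card_filter, Nat.cast_sum]
  refine Finset.sum_congr rfl fun e _ => ?_
  obtain ⟨a, b, h⟩ := exists_ends e
  simp only [mult_eq h, crossesB_eq h, Nat.cast_add, Finset.sum_add_distrib]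
  by_cases h1 : a ∈ A <;> by_cases h2 : b ∈ A <;>
    simp [h1, h2, CharTwo.add_self_eq_zero]

lemma even_boundary {S : Finset G.E} (h : par S = 0) (A : Finset G.V) :
    Even (G.boundary S A).card := by
  rw [← ZMod.natCast_eq_zero_iff_even, ← sum_par, h]; simp

lemma boundary_ne_singleton {S : Finset G.E} (h : par S = 0) (A : Finset G.V) (b : G.E) :
    G.boundary S A ≠ {b} := by
  intro hb
  have := even_boundary h A
  rw [hb] at this
  simp at this

lemma Adj.symm {S : Finset G.E} {u v : G.V} (h : G.Adj S u v) : G.Adj S v u := by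
  obtain ⟨e, he, h⟩ := h
  exact ⟨e, he, h.trans Sym2.eq_swap⟩

lemma Reach.symm {S : Finset G.E} {u v : G.V} (h : G.Reach S u v) : G.Reach S v u :=
  Relation.ReflTransGen.rec Relation.ReflTransGen.refl
    (fun _ h ih => Relation.ReflTransGen.head (Adj.symm h) ih) h

lemma Reach.mono {S T : Finset G.E} (hST : S ⊆ T) {u v : G.V} (h : G.Reach S u v) :
    G.Reach T u v :=
  Relation.ReflTransGen.rec Relation.ReflTransGen.refl
    (fun _ h ih => Relation.ReflTransGen.tail ih (h.imp fun _ h => ⟨hST h.1, h.2⟩)) h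

lemma Reach.trans {S : Finset G.E} {u v w : G.V} (h : G.Reach S u v) (h' : G.Reach S v w) :
    G.Reach S u w := Relation.ReflTransGen.trans h h'

lemma Reach.edge {S : Finset G.E} {e : G.E} (he : e ∈ S) {a b : G.V} (h : G.ends e = s(a, b)) :
    G.Reach S a b := Relation.ReflTransGen.single ⟨e, he, h⟩

lemma Reach.edge' {S : Finset G.E} {e : G.E} (he : e ∈ S) {a b : G.V} (ha : a ∈ G.ends e)
    (hb : b ∈ G.ends e) : G.Reach S a b := by
  obtain ⟨x, y, h⟩ := exists_ends e
  rw [h, Sym2.mem_iff] at ha hb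
  rcases ha with rfl | rfl <;> rcases hb with rfl | rfl
  · exact Relation.ReflTransGen.refl
  · exact Reach.edge he h
  · exact (Reach.edge he h).symm
  · exact Relation.ReflTransGen.refl

lemma Reach.mem_iff {S : Finset G.E} {A : Finset G.V} (hA : G.boundary S A = ∅) {u v : G.V}
    (h : G.Reach S u v) : u ∈ A ↔ v ∈ A := by
  induction h with
  | refl => rfl
  | tail _ h ih =>
    obtain ⟨e, he, h⟩ := h
    rw [ih]
    by_contra hne
    have := (mem_boundary (S := S) (A := A) h).2 ⟨he, hne⟩
    simp [hA] at this

lemma mem_comp {S : Finset G.E} {x v : G.V} : v ∈ comp S x ↔ G.Reach S x v := by simp [comp]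

lemma self_mem_comp (S : Finset G.E) (x : G.V) : x ∈ comp S x :=
  mem_comp.2 Relation.ReflTransGen.refl

lemma boundary_comp (S : Finset G.E) (x : G.V) : G.boundary S (comp S x) = ∅ := by
  ext e
  obtain ⟨a, b, h⟩ := exists_ends e
  rw [mem_boundary h]
  simp only [Finset.notMem_empty, iff_false, not_and, not_not, mem_comp]
  exact fun he => ⟨fun hx => hx.trans (Reach.edge he h), fun hx => hx.trans (Reach.edge he h).symm⟩

lemma mem_within_of_mem {S : Finset G.E} {A : Finset G.V} (hA : G.boundary S A = ∅) {e : G.E}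
    (he : e ∈ S) {u : G.V} (hu : u ∈ G.ends e) (huA : u ∈ A) : e ∈ within S A :=
  Finset.mem_filter.2 ⟨he, fun _ hv => (Reach.mem_iff hA (Reach.edge' he hu hv)).1 huA⟩

lemma par_within_notMem (S : Finset G.E) {A : Finset G.V} {v : G.V} (hv : v ∉ A) :
    par (within S A) v = 0 := by
  have : G.degIn (within S A) v = 0 := by
    rw [degIn_eq_zero_iff, mem_support]
    rintro ⟨e, he, hve⟩
    exact hv ((Finset.mem_filter.1 he).2 v hve)
  simp [par, this]

lemma par_within_mem {S : Finset G.E} {A : Finset G.V} (hA : G.boundary S A = ∅) {v : G.V}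
    (hv : v ∈ A) : par (within S A) v = par S v := by
  have h : G.degIn (S \ within S A) v = 0 := by
    rw [degIn_eq_zero_iff, mem_support]
    rintro ⟨e, he, hve⟩
    rw [Finset.mem_sdiff] at he
    exact he.2 (mem_within_of_mem hA he.1 hve hv)
  have h2 := congrFun (par_sdiff (within_subset S A)) v
  rw [Pi.add_apply, show par (S \ within S A) v = 0 by simp [par, h]] at h2
  exact (CharTwo.add_eq_zero.1 h2.symm).symm

lemma par_within_eq_zero {S : Finset G.E} {A : Finset G.V} (hA : G.boundary S A = ∅)
    (h : ∀ v ∈ A, par S v = 0) : par (within S A) = 0 := by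
  funext v
  by_cases hv : v ∈ A
  · rw [par_within_mem hA hv, h v hv]; rfl
  · rw [par_within_notMem S hv]; rfl

lemma exists_join {S : Finset G.E} {u v : G.V} (h : G.Reach S u v) :
    ∃ P ⊆ S, par P = Pi.single u 1 + Pi.single v 1 := by
  induction h with
  | refl =>
    exact ⟨∅, by simp, by rw [par_empty]; exact (vec_add_self _).symm⟩
  | @tail b c _ h ih =>
    obtain ⟨e, he, h⟩ := h
    obtain ⟨P, hP, hp⟩ := ih
    refine ⟨P ∆ {e}, ?_, ?_⟩
    · intro x hx
      rw [Finset.mem_symmDiff, Finset.mem_singleton] at hx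
      rcases hx with hx | hx
      · exact hP hx.1
      · exact hx.1 ▸ he
    · rw [par_symmDiff, hp, par_singleton h]
      linear_combination vec_add_self (Pi.single b 1 : G.V → ZMod 2)

/-- Existence of `T`-joins. -/
lemma exists_tjoin {S : Finset G.E} (t : G.V → ZMod 2)
    (ht : ∀ A : Finset G.V, G.boundary S A = ∅ → ∑ v ∈ A, t v = 0) :
    ∃ K ⊆ S, par K = t := by
  induction hn : (Finset.univ.filter fun v => t v ≠ 0).card using Nat.strong_induction_on
    generalizing t with
  | _ n ih =>
  subst hn
  by_cases h0 : ∃ v, t v ≠ 0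
  · obtain ⟨v, hv⟩ := h0
    have hone : ∀ {z : ZMod 2}, z ≠ 0 → z = 1 := by decide
    obtain ⟨w, hwA, hwv, hw⟩ : ∃ w ∈ comp S v, w ≠ v ∧ t w ≠ 0 := by
      by_contra! hcon
      have := ht _ (boundary_comp S v)
      rw [Finset.sum_eq_single_of_mem v (self_mem_comp S v) fun b hb hbv => hcon b hb hbv] at this
      exact hv this
    obtain ⟨P, hPS, hP⟩ := exists_join (mem_comp.1 hwA)
    have hlt : (Finset.univ.filter fun x => (t + par P) x ≠ 0).card <
        (Finset.univ.filter fun x => t x ≠ 0).card := by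
      refine Finset.card_lt_card (Finset.ssubset_iff.2 ⟨v, ?_, ?_⟩)
      · simp [hP, hwv.symm, hone hv, CharTwo.add_self_eq_zero]
      · intro x hx
        rw [Finset.mem_insert, Finset.mem_filter] at hx
        rw [Finset.mem_filter]
        rcases hx with rfl | hx
        · exact ⟨Finset.mem_univ _, hv⟩
        · refine ⟨Finset.mem_univ _, fun hx0 => ?_⟩
          by_cases hxv : x = v
          · exact hv (hxv ▸ hx0)
          · by_cases hxw : x = w
            · exact hw (hxw ▸ hx0)
            · exact hx.2 (by simp [hP, hx0, hxv, hxw])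
    have hsum : ∀ A : Finset G.V, G.boundary S A = ∅ → ∑ x ∈ A, (t + par P) x = 0 := by
      intro A hA
      have h2 : G.boundary P A = ∅ := Finset.subset_empty.1 (hA ▸ boundary_mono hPS A)
      simp [Finset.sum_add_distrib, ht A hA, sum_par, h2]
    obtain ⟨K, hKS, hK⟩ := ih _ hlt (t + par P) hsum rfl
    refine ⟨K ∆ P, ?_, ?_⟩
    · intro x hx
      rw [Finset.mem_symmDiff] at hx
      exact hx.elim (fun h => hKS h.1) fun h => hPS h.1
    · rw [par_symmDiff, hK]
      linear_combination vec_add_self (par P)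
  · push Not at h0
    exact ⟨∅, by simp, by rw [par_empty]; funext v; exact (h0 v).symm⟩

lemma exists_even_mem_of_reach {S : Finset G.E} {e : G.E} (he : e ∈ S) {a b : G.V}
    (h : G.ends e = s(a, b)) (hr : G.Reach (S.erase e) a b) : ∃ C ⊆ S, par C = 0 ∧ e ∈ C := by
  obtain ⟨P, hP, hp⟩ := exists_join hr
  have heP : e ∉ P := fun hx => by simpa using hP hx
  refine ⟨P ∪ {e}, Finset.union_subset (hP.trans (Finset.erase_subset _ _)) (by simpa using he),
    ?_, by simp⟩
  rw [par_union (by simpa using heP), hp, par_singleton h]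
  exact vec_add_self _

/-- An edge in no even subset of `S` is a bridge of `S`, with the bond being the component of
one of its ends. -/
lemma exists_boundary_of_not_even {S : Finset G.E} {e : G.E} (he : e ∈ S)
    (hno : ¬ ∃ C ⊆ S, par C = 0 ∧ e ∈ C) :
    ∃ a b, G.ends e = s(a, b) ∧ G.boundary S (comp (S.erase e) a) = {e} := by
  obtain ⟨a, b, h⟩ := exists_ends e
  have hr : ¬ G.Reach (S.erase e) a b := fun hr => hno (exists_even_mem_of_reach he h hr)
  refine ⟨a, b, h, ?_⟩
  ext f
  rw [Finset.mem_singleton]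
  constructor
  · intro hf
    by_contra hfe
    have := mem_boundary_of_subset hf (Finset.mem_erase.2 ⟨hfe, boundary_subset _ _ hf⟩)
    simp [boundary_comp] at this
  · rintro rfl
    rw [mem_boundary h]
    exact ⟨he, fun hh => hr (mem_comp.1 (hh.1 (self_mem_comp _ _)))⟩

lemma mem_of_even_of_cut {S C : Finset G.E} {A : Finset G.V} {e f : G.E} (hC : C ⊆ S)
    (hp : par C = 0) (hA : G.boundary S A ⊆ {e, f}) (he : e ∈ G.boundary C A) : f ∈ C := by
  by_contra hf
  refine boundary_ne_singleton hp A e ?_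
  ext x
  rw [Finset.mem_singleton]
  constructor
  · intro hx
    have := hA (boundary_mono hC A hx)
    rw [Finset.mem_insert, Finset.mem_singleton] at this
    rcases this with h | rfl
    · exact h
    · exact absurd (boundary_subset _ _ hx) hf
  · rintro rfl; exact he

lemma reach_within_comp {S : Finset G.E} {x v : G.V} (h : G.Reach S x v) :
    G.Reach (within S (comp S x)) x v := by
  induction h with
  | refl => exact Relation.ReflTransGen.refl
  | tail h' h ih =>
    obtain ⟨e, he, h⟩ := h
    refine ih.trans (Reach.edge ((mem_within h).2 ⟨he, mem_comp.2 h', ?_⟩) h)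
    exact mem_comp.2 (Reach.trans h' (Reach.edge he h))

lemma par_within_comp {S : Finset G.E} (h : par S = 0) (x : G.V) :
    par (within S (comp S x)) = 0 :=
  par_within_eq_zero (boundary_comp S x) fun v _ => by rw [h]; rfl

lemma Reach.mem_of_within {S T : Finset G.E} {W : Finset G.V} (hT : T ⊆ within S W) {x v : G.V}
    (hx : x ∈ W) (h : G.Reach T x v) : v ∈ W := by
  induction h with
  | refl => exact hx
  | tail _ h _ =>
    obtain ⟨e, he, h⟩ := h
    exact ((mem_within h).1 (hT he)).2.2

lemma boundary_univ (S : Finset G.E) : G.boundary S Finset.univ = ∅ := by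
  ext e
  obtain ⟨a, b, h⟩ := exists_ends e
  simp [mem_boundary h]

lemma sum_par_univ (S : Finset G.E) : ∑ v, par S v = 0 := by
  rw [sum_par, boundary_univ]; simp

lemma mem_ends_left {e : G.E} {a b : G.V} (h : G.ends e = s(a, b)) : a ∈ G.ends e := by simp [h]

lemma mem_ends_right {e : G.E} {a b : G.V} (h : G.ends e = s(a, b)) : b ∈ G.ends e := by simp [h]

lemma par_eq_zero_of_notMem_support {S : Finset G.E} {v : G.V} (h : v ∉ G.support S) :
    par S v = 0 := by simp [par, degIn_eq_zero_iff.2 h]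

/-- In a bridgeless edge set, a connected even subgraph through `x` and `y'` can be rerouted
to reach any neighbour `y` of `y'`. -/
lemma even_reach_step {S : Finset G.E} (hS : ∀ e ∈ S, ∃ C ⊆ S, par C = 0 ∧ e ∈ C)
    {x y' y : G.V} (hR : ∃ Z ⊆ S, par Z = 0 ∧ G.Reach Z x y') {g : G.E} (hg : g ∈ S)
    (hgy : G.ends g = s(y', y)) : ∃ Z ⊆ S, par Z = 0 ∧ G.Reach Z x y := by
  obtain ⟨Z₀, hZ₀S, hZ₀, hxy₀⟩ := hR
  set A := comp Z₀ x with hA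
  set Z := within Z₀ A with hZdef
  have hZS : Z ⊆ S := (within_subset _ _).trans hZ₀S
  have hZ : par Z = 0 := par_within_comp hZ₀ x
  have hxA : ∀ v ∈ A, G.Reach Z x v := fun v hv => reach_within_comp (mem_comp.1 hv)
  have hy'A : y' ∈ A := mem_comp.2 hxy₀
  by_cases hyA : y ∈ A
  · exact ⟨Z, hZS, hZ, hxA y hyA⟩
  obtain ⟨C₀, hC₀S, hC₀, hgC₀⟩ := hS g hg
  set R₀ := C₀ \ within C₀ A with hR₀
  set R := within R₀ (comp R₀ y') with hRdef
  have hRR₀ : R ⊆ R₀ := within_subset _ _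
  have hRS : R ⊆ S := hRR₀.trans (Finset.sdiff_subset.trans hC₀S)
  have hgR : g ∈ R := by
    have : g ∈ R₀ := by
      rw [hR₀, Finset.mem_sdiff, mem_within hgy]
      exact ⟨hgC₀, fun h => hyA h.2.2⟩
    exact mem_within_of_mem (boundary_comp _ _) this (mem_ends_left hgy) (self_mem_comp _ _)
  have hRconn : ∀ v ∈ G.support R, G.Reach R y' v := by
    intro v hv
    obtain ⟨e, he, hve⟩ := mem_support.1 hv
    exact reach_within_comp (mem_comp.1 ((Finset.mem_filter.1 he).2 v hve))
  have hparR : ∀ v, v ∉ A → par R v = 0 := by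
    intro v hv
    by_cases hvc : v ∈ comp R₀ y'
    · rw [hRdef, par_within_mem (boundary_comp _ _) hvc, hR₀, par_sdiff (within_subset _ _),
        Pi.add_apply, hC₀, par_within_notMem _ hv]
      simp
    · exact par_within_notMem _ hvc
  have hdisj : ∀ e ∈ R, e ∉ Z := by
    intro e he heZ
    have h1 := Finset.mem_sdiff.1 (hRR₀ he)
    exact h1.2 (Finset.mem_filter.2 ⟨h1.1, (Finset.mem_filter.1 heZ).2⟩)
  obtain ⟨K₀, hK₀Z, hK₀⟩ : ∃ K ⊆ Z, par K = par R := by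
    refine exists_tjoin _ fun B hB => ?_
    by_cases hxB : x ∈ B
    · rw [← sum_par_univ R]
      refine Finset.sum_subset (Finset.subset_univ _) fun v _ hv => hparR v fun hvA => ?_
      exact hv ((Reach.mem_iff hB (hxA v hvA)).1 hxB)
    · refine Finset.sum_eq_zero fun v hv => hparR v fun hvA => ?_
      exact hxB ((Reach.mem_iff hB (hxA v hvA)).2 hv)
  have hRK : Disjoint R K₀ := Finset.disjoint_left.2 fun e he hK => hdisj e he (hK₀Z hK)
  set C₁ := R ∪ K₀ with hC₁def
  have hC₁ : par C₁ = 0 := by rw [hC₁def, par_union hRK, hK₀]; exact vec_add_self _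
  set C := within C₁ (comp C₁ y') with hCdef
  have hC : par C = 0 := par_within_comp hC₁ y'
  have hCC₁ : C ⊆ C₁ := within_subset _ _
  have hRC : R ⊆ C := by
    intro e he
    obtain ⟨a, b, hab⟩ := exists_ends e
    refine mem_within_of_mem (boundary_comp _ _) (Finset.mem_union_left _ he) (mem_ends_left hab)
      (mem_comp.2 ?_)
    exact (hRconn a (mem_support.2 ⟨e, he, mem_ends_left hab⟩)).mono Finset.subset_union_left
  have hCconn : ∀ v ∈ G.support C, G.Reach C y' v := by
    intro v hv
    obtain ⟨e, he, hve⟩ := mem_support.1 hv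
    exact reach_within_comp (mem_comp.1 ((Finset.mem_filter.1 he).2 v hve))
  have hCS : C ⊆ S := hCC₁.trans (Finset.union_subset hRS (hK₀Z.trans hZS))
  set X := comp (Z \ C) x with hX
  by_cases hmeet : ∃ w ∈ X, w ∈ G.support R
  · obtain ⟨w, hwX, hwR⟩ := hmeet
    refine ⟨Z ∆ C, ?_, by rw [par_symmDiff, hZ, hC, add_zero], ?_⟩
    · intro e he
      rw [Finset.mem_symmDiff] at he
      exact he.elim (fun h => hZS h.1) fun h => hCS h.1
    · have h1 : Z \ C ⊆ Z ∆ C := fun e he => Finset.mem_symmDiff.2 (Or.inl (Finset.mem_sdiff.1 he))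
      have h2 : R ⊆ Z ∆ C := fun e he => Finset.mem_symmDiff.2 (Or.inr ⟨hRC he, hdisj e he⟩)
      refine ((mem_comp.1 hwX).mono h1).trans ?_
      exact ((hRconn w hwR).symm.trans (Reach.edge hgR hgy)).mono h2
  · push Not at hmeet
    have hy'X : y' ∉ X := fun h => hmeet y' h (mem_support.2 ⟨g, hgR, mem_ends_left hgy⟩)
    set M := within (Z \ C) X with hMdef
    have hM : par M = 0 := by
      refine par_within_eq_zero (boundary_comp _ _) fun v hv => ?_
      have h1 : Z \ C = Z \ (C \ R) := by
        ext e
        simp only [Finset.mem_sdiff]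
        have := hdisj e
        tauto
      have h2 : C \ R ⊆ Z := by
        intro e he
        rw [Finset.mem_sdiff] at he
        rcases Finset.mem_union.1 (hCC₁ he.1) with h | h
        · exact absurd h he.2
        · exact hK₀Z h
      rw [h1, par_sdiff h2, par_sdiff hRC, hZ, hC]
      simp [par_eq_zero_of_notMem_support (hmeet v hv)]
    have hCM : Disjoint C M := Finset.disjoint_left.2 fun e he hm =>
      (Finset.mem_sdiff.1 (within_subset _ _ hm)).2 he
    refine ⟨C ∪ M, Finset.union_subset hCS ?_, by rw [par_union hCM, hC, hM, add_zero], ?_⟩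
    · exact (within_subset _ _).trans (Finset.sdiff_subset.trans hZS)
    · obtain ⟨f, hf⟩ : (G.boundary Z X).Nonempty := by
        rw [Finset.nonempty_iff_ne_empty]
        intro h0
        exact hy'X ((Reach.mem_iff h0 (hxA y' hy'A)).1 (self_mem_comp _ _))
      obtain ⟨a, b, hab⟩ := exists_ends f
      have hfC : f ∈ C := by
        by_contra hfC
        have := mem_boundary_of_subset hf (Finset.mem_sdiff.2 ⟨boundary_subset _ _ hf, hfC⟩)
        rw [boundary_comp] at this
        simp at this
      obtain ⟨u, huf, huX⟩ : ∃ u ∈ G.ends f, u ∈ X := by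
        have := ((mem_boundary hab).1 hf).2
        by_cases ha : a ∈ X
        · exact ⟨a, mem_ends_left hab, ha⟩
        · exact ⟨b, mem_ends_right hab, by tauto⟩
      refine ((reach_within_comp (mem_comp.1 huX)).mono Finset.subset_union_right).trans ?_
      refine Reach.mono Finset.subset_union_left (S := C) ?_
      exact (hCconn u (mem_support.2 ⟨f, hfC, huf⟩)).symm.trans (Reach.edge (hRC hgR) hgy)

/-- Two vertices of a component of a bridgeless edge set lie in a common component of some even
subset. -/
lemma exists_even_reach {S : Finset G.E} (hS : ∀ e ∈ S, ∃ C ⊆ S, par C = 0 ∧ e ∈ C)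
    {x y : G.V} (h : G.Reach S x y) : ∃ Z ⊆ S, par Z = 0 ∧ G.Reach Z x y := by
  induction h with
  | refl => exact ⟨∅, by simp, par_empty, Relation.ReflTransGen.refl⟩
  | tail _ h ih =>
    obtain ⟨e, he, h⟩ := h
    exact even_reach_step hS ih he h

/-- Any two even subsets of `S` can be modified inside `Y` so that together they cover
`Y \ Z`. -/
def Ext (S Z Y : Finset G.E) : Prop :=
  ∀ A ⊆ S, par A = 0 → ∀ B ⊆ S, par B = 0 →
    ∃ A' ⊆ S, ∃ B' ⊆ S, par A' = 0 ∧ par B' = 0 ∧ A ∆ A' ⊆ Y ∧ B ∆ B' ⊆ Y ∧ Y \ Z ⊆ A' ∪ B'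

lemma Ext.self (S Z : Finset G.E) : Ext S Z Z := fun A hA hpA B hB hpB =>
  ⟨A, hA, B, hB, hpA, hpB, by simp, by simp, by simp⟩

lemma Ext.union {S Z Y : Finset G.E} (h : Ext S Z Y) (Z' : Finset G.E) :
    Ext S (Z ∪ Z') (Y ∪ Z') := by
  intro A hA hpA B hB hpB
  obtain ⟨A', hA', B', hB', h1, h2, h3, h4, h5⟩ := h A hA hpA B hB hpB
  refine ⟨A', hA', B', hB', h1, h2, h3.trans Finset.subset_union_left,
    h4.trans Finset.subset_union_left, fun e he => h5 ?_⟩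
  simp only [Finset.mem_sdiff, Finset.mem_union] at he ⊢
  tauto

lemma exists_toggle {S A C : Finset G.E} (hA : A ⊆ S) (hC : C ⊆ S) (hpA : par A = 0)
    (hpC : par C = 0) {e : G.E} (he : e ∈ C) :
    ∃ A₁ ⊆ S, par A₁ = 0 ∧ e ∈ A₁ ∧ A ∆ A₁ ⊆ C := by
  by_cases h : e ∈ A
  · exact ⟨A, hA, hpA, h, by simp⟩
  · refine ⟨A ∆ C, ?_, by rw [par_symmDiff, hpA, hpC, add_zero], ?_, ?_⟩
    · intro x hx
      rw [Finset.mem_symmDiff] at hx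
      exact hx.elim (fun h => hA h.1) fun h => hC h.1
    · exact Finset.mem_symmDiff.2 (Or.inr ⟨he, h⟩)
    · rw [symmDiff_symmDiff_cancel_left]

lemma Ext.step {S Z Y C : Finset G.E} (h : Ext S Z Y) (hC : C ⊆ S) (hpC : par C = 0) {e f : G.E}
    (he : e ∈ C) (hf : f ∈ C) (hCY : C \ Y ⊆ {e, f}) : Ext S Z (Y ∪ C) := by
  intro A hA hpA B hB hpB
  obtain ⟨A₁, hA₁, hpA₁, heA, hAC⟩ := exists_toggle hA hC hpA hpC he
  obtain ⟨B₁, hB₁, hpB₁, hfB, hBC⟩ := exists_toggle hB hC hpB hpC hf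
  obtain ⟨A', hA', B', hB', h1, h2, h3, h4, h5⟩ := h A₁ hA₁ hpA₁ B₁ hB₁ hpB₁
  refine ⟨A', hA', B', hB', h1, h2, ?_, ?_, ?_⟩
  · intro x hx
    have := @hAC x
    have := @h3 x
    simp only [Finset.mem_symmDiff, Finset.mem_union] at *
    tauto
  · intro x hx
    have := @hBC x
    have := @h4 x
    simp only [Finset.mem_symmDiff, Finset.mem_union] at *
    tauto
  · intro x hx
    have hx5 := @h5 x
    by_cases hxY : x ∈ Y
    · simp only [Finset.mem_sdiff, Finset.mem_union] at *
      tauto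
    · have hxC : x ∈ C := by
        simp only [Finset.mem_sdiff, Finset.mem_union] at hx
        tauto
      have hx3 := @h3 x
      have hx4 := @h4 x
      have := hCY (Finset.mem_sdiff.2 ⟨hxC, hxY⟩)
      rw [Finset.mem_insert, Finset.mem_singleton] at this
      simp only [Finset.mem_symmDiff, Finset.mem_union] at *
      rcases this with rfl | rfl <;> tauto

lemma Ext.add_edges {S Z Y T : Finset G.E} (h : Ext S Z Y) (hY : Y ⊆ T) (hT : T ⊆ S)
    (hconn : ∀ f ∈ T, ∀ a b, G.ends f = s(a, b) → G.Reach Y a b) : Ext S Z T := by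
  suffices H : ∀ D : Finset G.E, D ⊆ T → Ext S Z (Y ∪ D) by
    simpa [Finset.union_eq_right.2 hY] using H T subset_rfl
  intro D
  induction D using Finset.induction_on with
  | empty => intro _; simpa using h
  | insert f D hfD ih =>
    intro hD
    have ih := ih ((Finset.subset_insert _ _).trans hD)
    have hfT : f ∈ T := hD (Finset.mem_insert_self _ _)
    by_cases hfY : f ∈ Y ∪ D
    · rwa [Finset.union_insert, Finset.insert_eq_of_mem hfY]
    obtain ⟨a, b, hab⟩ := exists_ends f
    have hr : G.Reach ((insert f (Y ∪ D)).erase f) a b := by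
      rw [Finset.erase_insert hfY]
      exact (hconn f hfT a b hab).mono Finset.subset_union_left
    obtain ⟨C, hC, hpC, hfC⟩ := exists_even_mem_of_reach (Finset.mem_insert_self f _) hab hr
    have hsub : insert f (Y ∪ D) ⊆ S := by
      intro x hx
      rw [Finset.mem_insert, Finset.mem_union] at hx
      rcases hx with rfl | hx | hx
      · exact hT hfT
      · exact hT (hY hx)
      · exact hT (hD (Finset.mem_insert_of_mem hx))
    have := ih.step (hC.trans hsub) hpC hfC hfC (by
      intro x hx
      rw [Finset.mem_sdiff] at hx
      have := hC hx.1
      rw [Finset.mem_insert] at this ⊢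
      tauto)
    convert this using 1
    ext x
    have := @hC x
    simp only [Finset.mem_union, Finset.mem_insert] at this ⊢
    constructor
    · rintro (h | rfl | h) <;> tauto
    · tauto

/-- The induction hypothesis for building `Ext`: `U` meets every component, spans a subgraph as
connected as `S`, and the edges inside `U` have been absorbed up to an even set. -/
def Absorbed (S : Finset G.E) (U : Finset G.V) : Prop :=
  (∃ Z ⊆ within S U, par Z = 0 ∧ Ext S Z (within S U)) ∧
    (∀ u ∈ U, ∀ v ∈ U, G.Reach S u v → G.Reach (within S U) u v) ∧
    ∀ v, ∃ u ∈ U, G.Reach S v u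

lemma exists_absorbed (S : Finset G.E) : ∃ U, Absorbed S U := by
  let st : Setoid G.V := ⟨G.Reach S, fun _ => Relation.ReflTransGen.refl, Reach.symm, Reach.trans⟩
  have hout : ∀ v, G.Reach S (Quotient.mk st v).out v := fun v => Quotient.mk_out (s := st) v
  let U : Finset G.V := Finset.univ.image fun v => (Quotient.mk st v).out
  have hU : ∀ u ∈ U, ∀ v ∈ U, G.Reach S u v → u = v := by
    intro u hu v hv huv
    simp only [U, Finset.mem_image, Finset.mem_univ, true_and] at hu hv
    obtain ⟨u', rfl⟩ := hu
    obtain ⟨v', rfl⟩ := hv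
    have : G.Reach S u' v' := ((hout u').symm.trans huv).trans (hout v')
    rw [Quotient.sound (s := st) this]
  refine ⟨U, ⟨∅, by simp, par_empty, ?_⟩, ?_, ?_⟩
  · refine (Ext.self S ∅).add_edges (by simp) (within_subset _ _) fun f hf a b hab => ?_
    rw [mem_within hab] at hf
    rw [hU a hf.2.1 b hf.2.2 (Reach.edge hf.1 hab)]
    exact Relation.ReflTransGen.refl
  · intro u hu v hv huv
    rw [hU u hu v hv huv]
    exact Relation.ReflTransGen.refl
  · intro v
    exact ⟨_, Finset.mem_image_of_mem _ (Finset.mem_univ v), (hout v).symm⟩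

lemma boundary_eq_empty_of_card_le_two {S : Finset G.E}
    (hS : ∀ e ∈ S, ∃ C ⊆ S, par C = 0 ∧ e ∈ C)
    (hsep : ∀ e ∈ S, ∀ f ∈ S, e ≠ f → ∃ C ⊆ S, par C = 0 ∧ ¬ (e ∈ C ↔ f ∈ C))
    {A : Finset G.V} (hA : (G.boundary S A).card ≤ 2) : G.boundary S A = ∅ := by
  by_contra hne
  obtain ⟨e, he⟩ := Finset.nonempty_iff_ne_empty.2 hne
  have heS := boundary_subset _ _ he
  by_cases h1 : ∃ f ∈ G.boundary S A, f ≠ e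
  · obtain ⟨f, hf, hfe⟩ := h1
    have hfS := boundary_subset _ _ hf
    have heq : {e, f} = G.boundary S A := by
      refine Finset.eq_of_subset_of_card_le ?_ ?_
      · intro x hx
        rw [Finset.mem_insert, Finset.mem_singleton] at hx
        rcases hx with rfl | rfl <;> assumption
      · rw [Finset.card_pair hfe.symm]; exact hA
    obtain ⟨C, hC, hp, hn⟩ := hsep e heS f hfS hfe.symm
    refine hn ⟨fun h => ?_, fun h => ?_⟩
    · exact mem_of_even_of_cut hC hp heq.ge (mem_boundary_of_subset he h)
    · refine mem_of_even_of_cut hC hp ?_ (mem_boundary_of_subset hf h)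
      rw [Finset.pair_comm]; exact heq.ge
  · push Not at h1
    obtain ⟨C, hC, hp, heC⟩ := hS e heS
    refine boundary_ne_singleton hp A e (Finset.eq_singleton_iff_unique_mem.2 ⟨?_, ?_⟩)
    · exact mem_boundary_of_subset he heC
    · exact fun x hx => h1 x (boundary_mono hC A hx)

lemma boundary_within_inter (S : Finset G.E) (W A : Finset G.V) :
    G.boundary (within S W) (A ∩ W) = G.boundary (within S W) A := by
  ext e
  obtain ⟨a, b, h⟩ := exists_ends e
  simp only [mem_boundary h, mem_within h, Finset.mem_inter]
  tauto

lemma boundary_within_self (S : Finset G.E) (W : Finset G.V) :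
    G.boundary (within S W) W = ∅ := by
  ext e
  obtain ⟨a, b, h⟩ := exists_ends e
  simp only [mem_boundary h, mem_within h, Finset.notMem_empty, iff_false]
  tauto

lemma boundary_empty_set (S : Finset G.E) : G.boundary S ∅ = ∅ := by
  ext e
  obtain ⟨a, b, h⟩ := exists_ends e
  simp [mem_boundary h]

lemma notMem_boundary_sdiff {S : Finset G.E} {W A : Finset G.V} (hAW : A ⊆ W) {e : G.E}
    (hA : e ∈ G.boundary S A) (hW : e ∈ G.boundary S W) : e ∉ G.boundary S (W \ A) := by
  obtain ⟨a, b, h⟩ := exists_ends e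
  have hA1 := @hAW a
  have hA2 := @hAW b
  simp only [mem_boundary h, Finset.mem_sdiff] at *
  tauto

lemma mem_symmDiff_pair {α : Type*} {P Q Y Y' : Finset α} {e f : α} (hP : P ⊆ Y) (hQ : Q ⊆ Y')
    (he : e ∉ Y ∧ e ∉ Y') (hf : f ∉ Y ∧ f ∉ Y') (hne : e ≠ f) :
    (∀ x ∈ (P ∆ Q) ∆ ({e} ∆ {f}), x = e ∨ x = f ∨ x ∈ Y ∨ x ∈ Y') ∧
      e ∈ (P ∆ Q) ∆ ({e} ∆ {f}) ∧ f ∈ (P ∆ Q) ∆ ({e} ∆ {f}) := by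
  refine ⟨fun x hx => ?_, ?_, ?_⟩
  · have h1 := @hP x
    have h2 := @hQ x
    simp only [Finset.mem_symmDiff, Finset.mem_singleton] at hx
    tauto
  · have h1 := @hP e
    have h2 := @hQ e
    simp only [Finset.mem_symmDiff, Finset.mem_singleton]
    tauto
  · have h1 := @hP f
    have h2 := @hQ f
    have := hne.symm
    simp only [Finset.mem_symmDiff, Finset.mem_singleton]
    tauto

/-- A vertex set with at most one boundary edge in the graph outside `U` and minimal with this
property induces a bridgeless connected subgraph. -/
lemma exists_minimal_block {S : Finset G.E}
    (hS : ∀ e ∈ S, ∃ C ⊆ S, par C = 0 ∧ e ∈ C)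
    (hsep : ∀ e ∈ S, ∀ f ∈ S, e ≠ f → ∃ C ⊆ S, par C = 0 ∧ ¬ (e ∈ C ↔ f ∈ C))
    {U : Finset G.V} (hU : ∀ v, ∃ u ∈ U, G.Reach S v u) (hne : U ≠ Finset.univ) :
    ∃ W : Finset G.V, Disjoint W U ∧
      (∀ e ∈ within S W, ∃ C ⊆ within S W, par C = 0 ∧ e ∈ C) ∧
      (∀ x ∈ W, ∀ y ∈ W, G.Reach (within S W) x y) ∧
      ∃ e₁ ∈ S, ∃ e₂ ∈ S, e₁ ≠ e₂ ∧ ∃ x ∈ W, ∃ y ∈ W, ∃ u ∈ U, ∃ v ∈ U,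
        G.ends e₁ = s(x, u) ∧ G.ends e₂ = s(y, v) := by
  set S₀ := within S Uᶜ with hS₀
  have hex : ∃ W : Finset G.V, W.Nonempty ∧ W ⊆ Uᶜ ∧ (G.boundary S₀ W).card ≤ 1 := by
    refine ⟨Uᶜ, ?_, subset_rfl, ?_⟩
    · rw [Finset.nonempty_iff_ne_empty]
      simpa using hne
    · have : G.boundary S₀ Uᶜ = ∅ := by
        ext e
        obtain ⟨a, b, h⟩ := exists_ends e
        rw [mem_boundary h, hS₀, mem_within h]
        simp only [Finset.notMem_empty, iff_false]
        tauto
      simp [this]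
  obtain ⟨W, ⟨hW1, hW2, hW3⟩, hmin⟩ : ∃ W : Finset G.V,
      (W.Nonempty ∧ W ⊆ Uᶜ ∧ (G.boundary S₀ W).card ≤ 1) ∧
      ∀ A, A.Nonempty → A ⊆ W → A ≠ W → 2 ≤ (G.boundary S₀ A).card := by
    obtain ⟨W, hW, hmin⟩ := Set.Finite.exists_minimal
      (Set.toFinite {W : Finset G.V | W.Nonempty ∧ W ⊆ Uᶜ ∧ (G.boundary S₀ W).card ≤ 1}) hex
    refine ⟨W, hW, fun A hA hAW hne => ?_⟩
    by_contra hcard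
    exact hne (le_antisymm hAW (hmin ⟨hA, hAW.trans hW.2.1, by omega⟩ hAW))
  have hWU : ∀ v ∈ W, v ∉ U := fun v hv => by simpa using hW2 hv
  -- the cuts of the induced subgraph
  have hcut : ∀ A, A.Nonempty → A ⊆ W → A ≠ W → 2 ≤ (G.boundary (within S W) A).card := by
    intro A hA hAW hAne
    by_contra hlt
    have hB : (W \ A).Nonempty := by
      rw [Finset.sdiff_nonempty]
      exact fun h => hAne (hAW.antisymm h)
    have hBne : W \ A ≠ W := by
      obtain ⟨a, ha⟩ := hA
      intro h
      have := h.ge (hAW ha)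
      rw [Finset.mem_sdiff] at this
      exact this.2 ha
    have key : ∀ e ∈ S₀, e ∉ G.boundary S₀ W →
        (e ∈ G.boundary S₀ A → e ∈ G.boundary (within S W) A) ∧
        (e ∈ G.boundary S₀ (W \ A) → e ∈ G.boundary (within S W) A) := by
      intro e he heW
      obtain ⟨a, b, h⟩ := exists_ends e
      have hA1 := @hAW a
      have hA2 := @hAW b
      have heS := within_subset _ _ he
      rw [mem_boundary h] at heW
      simp only [mem_boundary h, mem_within h, Finset.mem_sdiff]
      tauto
    have h2A := hmin A hA hAW hAne
    have h2B := hmin (W \ A) hB Finset.sdiff_subset hBne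
    have hexA : ∃ e ∈ G.boundary S₀ A, e ∈ G.boundary S₀ W := by
      by_contra! hcon
      have : G.boundary S₀ A ⊆ G.boundary (within S W) A := fun e he =>
        (key e (boundary_subset _ _ he) (hcon e he)).1 he
      have := Finset.card_le_card this
      omega
    have hexB : ∃ e ∈ G.boundary S₀ (W \ A), e ∈ G.boundary S₀ W := by
      by_contra! hcon
      have : G.boundary S₀ (W \ A) ⊆ G.boundary (within S W) A := fun e he =>
        (key e (boundary_subset _ _ he) (hcon e he)).2 he
      have := Finset.card_le_card this
      omega
    obtain ⟨e, heA, heW⟩ := hexA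
    obtain ⟨f, hfB, hfW⟩ := hexB
    obtain rfl : e = f := Finset.card_le_one.1 hW3 e heW f hfW
    exact notMem_boundary_sdiff hAW heA heW hfB
  have hcut' : ∀ A : Finset G.V, (G.boundary (within S W) A).card ≤ 1 →
      G.boundary (within S W) A = ∅ ∧ ∀ x ∈ W, ∀ y ∈ W, x ∈ A → y ∈ A := by
    intro A hA
    have heq := boundary_within_inter S W A
    have hor : A ∩ W = ∅ ∨ A ∩ W = W := by
      by_contra! hcon
      have := hcut (A ∩ W) hcon.1 Finset.inter_subset_right hcon.2
      rw [heq] at this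
      omega
    constructor
    · rw [← heq]
      rcases hor with h' | h' <;> rw [h']
      · exact boundary_empty_set _
      · exact boundary_within_self S W
    · intro x hx y hy hxA
      rcases hor with h' | h'
      · have : x ∈ A ∩ W := Finset.mem_inter.2 ⟨hxA, hx⟩
        rw [h'] at this
        simp at this
      · exact (Finset.mem_inter.1 (h'.ge hy)).1
  refine ⟨W, Finset.disjoint_left.2 hWU, ?_, ?_, ?_⟩
  · intro e he
    by_contra hno
    obtain ⟨a, b, _, hb⟩ := exists_boundary_of_not_even he hno
    have := (hcut' _ (by rw [hb]; simp)).1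
    rw [hb] at this
    simp at this
  · intro x hx y hy
    exact mem_comp.1 ((hcut' _ (by rw [boundary_comp]; simp)).2 x hx y hy (self_mem_comp _ _))
  · have hbd : ∀ e ∈ G.boundary S W \ S₀, ∃ x ∈ W, ∃ u ∈ U, G.ends e = s(x, u) := by
      intro e he
      obtain ⟨a, b, h⟩ := exists_ends e
      rw [Finset.mem_sdiff, mem_boundary h, hS₀, mem_within h, Finset.mem_compl,
        Finset.mem_compl] at he
      have ha := hWU a
      have hb := hWU b
      by_cases haW : a ∈ W
      · exact ⟨a, haW, b, by tauto, h⟩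
      · exact ⟨b, by tauto, a, by tauto, h.trans Sym2.eq_swap⟩
    have hcard : 1 < (G.boundary S W \ S₀).card := by
      by_contra hle
      have h1 : G.boundary S W ⊆ G.boundary S₀ W ∪ (G.boundary S W \ S₀) := by
        intro e he
        by_cases heS : e ∈ S₀
        · exact Finset.mem_union_left _ (mem_boundary_of_subset he heS)
        · exact Finset.mem_union_right _ (Finset.mem_sdiff.2 ⟨he, heS⟩)
      have h2 := (Finset.card_le_card h1).trans (Finset.card_union_le _ _)
      have h3 := boundary_eq_empty_of_card_le_two hS hsep (A := W) (by omega)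
      obtain ⟨w, hw⟩ := hW1
      obtain ⟨u, hu, hwu⟩ := hU w
      exact hWU u ((Reach.mem_iff h3 hwu).1 hw) hu
    obtain ⟨e₁, h1, e₂, h2, hne⟩ := Finset.one_lt_card.1 hcard
    obtain ⟨x, hx, u, hu, hxu⟩ := hbd e₁ h1
    obtain ⟨y, hy, v, hv, hyv⟩ := hbd e₂ h2
    exact ⟨e₁, boundary_subset _ _ (Finset.mem_sdiff.1 h1).1, e₂,
      boundary_subset _ _ (Finset.mem_sdiff.1 h2).1, hne, x, hx, y, hy, u, hu, v, hv, hxu, hyv⟩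

lemma Absorbed.extend {S : Finset G.E}
    (hS : ∀ e ∈ S, ∃ C ⊆ S, par C = 0 ∧ e ∈ C)
    (hsep : ∀ e ∈ S, ∀ f ∈ S, e ≠ f → ∃ C ⊆ S, par C = 0 ∧ ¬ (e ∈ C ↔ f ∈ C))
    {U : Finset G.V} (hU : Absorbed S U) (hne : U ≠ Finset.univ) :
    ∃ U', Absorbed S U' ∧ U.card < U'.card := by
  obtain ⟨⟨Z, hZS, hZ, hExt⟩, hconn, hrep⟩ := hU
  obtain ⟨W, hWU, hWS, hWc, e₁, he₁, e₂, he₂, h12, x, hx, y, hy, u, hu, v, hv, hxu, hyv⟩ :=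
    exists_minimal_block hS hsep hrep hne
  obtain ⟨Z₁, hZ₁W, hZ₁, hxy⟩ := exists_even_reach hWS (hWc x hx y hy)
  set A := comp Z₁ x with hA
  set Z' := within Z₁ A with hZ'def
  have hZ' : par Z' = 0 := par_within_comp hZ₁ x
  have hxA : ∀ w ∈ A, G.Reach Z' x w := fun w hw => reach_within_comp (mem_comp.1 hw)
  have hAW : A ⊆ W := fun w hw => Reach.mem_of_within hZ₁W hx (mem_comp.1 hw)
  have hAU : ∀ w ∈ A, w ∉ U := fun w hw => Finset.disjoint_left.1 hWU (hAW hw)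
  have hyA : y ∈ A := mem_comp.2 hxy
  have hZ'S : Z' ⊆ S := (within_subset _ _).trans (hZ₁W.trans (within_subset _ _))
  have hxA' : x ∈ A := self_mem_comp _ _
  have hne1 : ∀ {e : G.E} {w z : G.V}, w ∈ A → z ∈ U → G.ends e = s(w, z) →
      e ∉ within S U ∧ e ∉ Z' := by
    intro e w z hw hz h
    have := hAU w hw
    rw [mem_within h, hZ'def, mem_within h]
    have := hAU z
    tauto
  have hn1 := hne1 hxA' hu hxu
  have hn2 := hne1 hyA hv hyv
  have huv : G.Reach S u v := by
    refine (Reach.edge he₁ hxu).symm.trans (Reach.trans ?_ (Reach.edge he₂ hyv))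
    exact (hWc x hx y hy).mono (within_subset _ _)
  obtain ⟨P, hPS, hP⟩ := exists_join (hconn u hu v hv huv)
  obtain ⟨Q, hQS, hQ⟩ := exists_join (hxA y hyA)
  set C := (P ∆ Q) ∆ ({e₁} ∆ {e₂}) with hCdef
  have hpC : par C = 0 := by
    rw [hCdef, par_symmDiff, par_symmDiff, par_symmDiff, hP, hQ, par_singleton hxu,
      par_singleton hyv]
    linear_combination vec_add_self (Pi.single x 1 : G.V → ZMod 2) +
      vec_add_self (Pi.single y 1 : G.V → ZMod 2) +
      vec_add_self (Pi.single u 1 : G.V → ZMod 2) + vec_add_self (Pi.single v 1 : G.V → ZMod 2)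
  obtain ⟨hCmem, hC1, hC2⟩ := mem_symmDiff_pair hPS hQS hn1 hn2 h12
  rw [← hCdef] at hCmem hC1 hC2
  have hCS : C ⊆ S := by
    intro e he
    rcases hCmem e he with rfl | rfl | h | h
    · exact he₁
    · exact he₂
    · exact within_subset _ _ h
    · exact hZ'S h
  have hExt' : Ext S (Z ∪ Z') ((within S U ∪ Z') ∪ C) := by
    refine (hExt.union Z').step hCS hpC hC1 hC2 fun e he => ?_
    rw [Finset.mem_sdiff, Finset.mem_union] at he
    rw [Finset.mem_insert, Finset.mem_singleton]
    have := hCmem e he.1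
    tauto
  have hsub : (within S U ∪ Z') ∪ C ⊆ within S (U ∪ A) := by
    have hUU : within S U ⊆ within S (U ∪ A) := by
      intro e he
      exact Finset.mem_filter.2 ⟨within_subset _ _ he,
        fun w hw => Finset.mem_union_left _ ((Finset.mem_filter.1 he).2 w hw)⟩
    have hZU : Z' ⊆ within S (U ∪ A) := by
      intro e he
      exact Finset.mem_filter.2 ⟨hZ'S he,
        fun w hw => Finset.mem_union_right _ ((Finset.mem_filter.1 he).2 w hw)⟩
    refine Finset.union_subset (Finset.union_subset hUU hZU) fun e he => ?_
    rcases hCmem e he with rfl | rfl | h | h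
    · rw [mem_within hxu]
      simp [he₁, hu, hxA']
    · rw [mem_within hyv]
      simp [he₂, hv, hyA]
    · exact hUU h
    · exact hZU h
  set Y := (within S U ∪ Z') ∪ C with hY
  have hYS : Y ⊆ S := hsub.trans (within_subset _ _)
  have hto : ∀ w ∈ U ∪ A, ∃ z ∈ U, G.Reach Y w z := by
    intro w hw
    rcases Finset.mem_union.1 hw with h | h
    · exact ⟨w, h, Relation.ReflTransGen.refl⟩
    · refine ⟨u, hu, ?_⟩
      refine (((hxA w h).symm.mono ?_).trans (Reach.edge ?_ hxu))
      · exact Finset.subset_union_right.trans Finset.subset_union_left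
      · exact Finset.mem_union_right _ hC1
  have hYconn : ∀ w ∈ U ∪ A, ∀ z ∈ U ∪ A, G.Reach S w z → G.Reach Y w z := by
    intro w hw z hz hwz
    obtain ⟨w', hw', hww⟩ := hto w hw
    obtain ⟨z', hz', hzz⟩ := hto z hz
    have h1 := hconn w' hw' z' hz' (((hww.mono hYS).symm.trans hwz).trans (hzz.mono hYS))
    refine (hww.trans (h1.mono ?_)).trans hzz.symm
    exact Finset.subset_union_left.trans Finset.subset_union_left
  refine ⟨U ∪ A, ⟨⟨Z ∪ Z', ?_, ?_, ?_⟩, ?_, ?_⟩, ?_⟩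
  · refine (Finset.union_subset_union hZS subset_rfl).trans ?_
    exact Finset.subset_union_left.trans hsub
  · rw [par_union, hZ, hZ', add_zero]
    refine Finset.disjoint_left.2 fun e he he' => ?_
    obtain ⟨a, b, hab⟩ := exists_ends e
    exact hAU a ((mem_within hab).1 he').2.1 ((mem_within hab).1 (hZS he)).2.1
  · refine hExt'.add_edges hsub (within_subset _ _) fun f hf a b hab => ?_
    rw [mem_within hab] at hf
    exact hYconn a hf.2.1 b hf.2.2 (Reach.edge hf.1 hab)
  · exact fun w hw z hz hwz => (hYconn w hw z hz hwz).mono hsub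
  · intro w
    obtain ⟨z, hz, hwz⟩ := hrep w
    exact ⟨z, Finset.mem_union_left _ hz, hwz⟩
  · refine Finset.card_lt_card (Finset.ssubset_iff.2 ⟨x, hAU x hxA', ?_⟩)
    intro w hw
    rw [Finset.mem_insert] at hw
    rcases hw with rfl | hw
    · exact Finset.mem_union_right _ hxA'
    · exact Finset.mem_union_left _ hw

lemma exists_three_even_of_separated {S : Finset G.E}
    (hS : ∀ e ∈ S, ∃ C ⊆ S, par C = 0 ∧ e ∈ C)
    (hsep : ∀ e ∈ S, ∀ f ∈ S, e ≠ f → ∃ C ⊆ S, par C = 0 ∧ ¬ (e ∈ C ↔ f ∈ C)) :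
    ∃ Z₁ ⊆ S, ∃ Z₂ ⊆ S, ∃ Z₃ ⊆ S, par Z₁ = 0 ∧ par Z₂ = 0 ∧ par Z₃ = 0 ∧
      S ⊆ Z₁ ∪ Z₂ ∪ Z₃ := by
  obtain ⟨U₀, hU₀⟩ := exists_absorbed S
  obtain ⟨U, hU, hmax⟩ := Finset.exists_max_image (Finset.univ.filter fun U => Absorbed S U)
    Finset.card ⟨U₀, by simpa using hU₀⟩
  have hUuniv : U = Finset.univ := by
    by_contra hne
    obtain ⟨U', hU', hlt⟩ := Absorbed.extend hS hsep (by simpa using hU) hne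
    exact absurd (hmax U' (by simpa using hU')) (by omega)
  subst hUuniv
  have hw : within S Finset.univ = S := by simp [within]
  obtain ⟨⟨Z, hZS, hZ, hExt⟩, -⟩ : Absorbed S Finset.univ := by simpa using hU
  rw [hw] at hZS hExt
  obtain ⟨A, hA, B, hB, hpA, hpB, -, -, hcov⟩ :=
    hExt ∅ (by simp) par_empty ∅ (by simp) par_empty
  refine ⟨Z, hZS, A, hA, B, hB, hZ, hpA, hpB, fun e he => ?_⟩
  have := @hcov e
  simp only [Finset.mem_sdiff, Finset.mem_union] at this ⊢
  tauto

/-- The graph obtained by identifying vertices along `q`. -/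
@[reducible] def identify (G : SignedMultigraph) (q : G.V → G.V) : SignedMultigraph where
  V := G.V
  E := G.E
  ends e := (G.ends e).map q
  neg := G.neg

lemma par_identify (q : G.V → G.V) (T : Finset G.E) (w : G.V) :
    par (G := G.identify q) T w = ∑ v, if q v = w then par T v else 0 := by
  have h1 : ∀ v, (if q v = w then par T v else 0) = ∑ e ∈ T,
      (if q v = w then ((if G.ends e = Sym2.diag v then 2 else if v ∈ G.ends e then 1 else 0 : ℕ)
        : ZMod 2) else 0) := by
    intro v
    split_ifs with h
    · simp only [par, degIn, Nat.cast_sum]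
    · simp
  simp only [h1]
  rw [Finset.sum_comm, par, degIn, Nat.cast_sum]
  refine Finset.sum_congr rfl fun e _ => ?_
  obtain ⟨a, b, h⟩ := exists_ends (G := G) e
  have h' : (G.identify q).ends e = s(q a, q b) := by
    show (G.ends e).map q = _
    rw [h, Sym2.map_mk]
  rw [mult_eq h']
  simp only [mult_eq h, Nat.cast_add, ite_add_zero, Finset.sum_add_distrib]
  simp only [Nat.cast_ite, Nat.cast_one, Nat.cast_zero]
  have key : ∀ c : G.V, (if q c = w then 1 else 0 : ZMod 2) =
      ∑ x, if q x = w then (if c = x then 1 else 0) else 0 := by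
    intro c
    rw [Finset.sum_eq_single c]
    · simp
    · intro b _ hb
      simp [hb.symm]
    · simp
  rw [key a, key b]

lemma par_identify_singleton {f : G.E} {u v : G.V} (hf : G.ends f = s(u, v)) :
    par (G := G.identify (Function.update id v u)) ({f} : Finset G.E) = 0 := by
  have h : (G.identify (Function.update id v u)).ends f = s(u, u) := by
    show (G.ends f).map _ = _
    rw [hf, Sym2.map_mk]
    by_cases huv : u = v
    · subst huv; simp
    · simp [Function.update_of_ne huv]
  rw [par_singleton h]
  exact vec_add_self _

lemma par_identify_of_par {T : Finset G.E} (h : par T = 0) (q : G.V → G.V) :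
    par (G := G.identify q) T = 0 := by
  funext w
  rw [par_identify, h]
  simp

/-- An even set of the contraction by `f` lifts to an even set, adding `f` if needed. -/
lemma exists_lift_of_par_identify {f : G.E} {u v : G.V} (hf : G.ends f = s(u, v)) (huv : u ≠ v)
    {T : Finset G.E} (hfT : f ∉ T)
    (hT : par (G := G.identify (Function.update id v u)) T = 0) :
    par T = 0 ∨ par (insert f T) = 0 := by
  have hother : ∀ w, w ≠ u → w ≠ v → par T w = 0 := by
    intro w hwu hwv
    have h := congrFun hT w
    rw [par_identify, Finset.sum_eq_single w] at h
    · simpa [hwv] using h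
    · intro x _ hxw
      by_cases hxv : x = v
      · simp [hxv, hwu.symm]
      · simp [Function.update_of_ne hxv, hxw]
    · simp
  have hsum : par T u + par T v = 0 := by
    have h := sum_par_univ T
    rw [← Finset.add_sum_erase _ _ (Finset.mem_univ u),
      ← Finset.add_sum_erase (Finset.univ.erase u) _
        (Finset.mem_erase.2 ⟨huv.symm, Finset.mem_univ v⟩),
      Finset.sum_eq_zero (s := (Finset.univ.erase u).erase v)] at h
    · simpa using h
    · intro x hx
      simp only [Finset.mem_erase] at hx
      exact hother x hx.2.1 hx.1
  have huv' : par T u = par T v := CharTwo.add_eq_zero.1 hsum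
  have hone : ∀ z : ZMod 2, z = 0 ∨ z = 1 := by decide
  rcases hone (par T u) with h0 | h1
  · left
    funext w
    by_cases hwu : w = u
    · rw [hwu, h0]; rfl
    by_cases hwv : w = v
    · rw [hwv, ← huv', h0]; rfl
    exact hother w hwu hwv
  · right
    rw [Finset.insert_eq, Finset.union_comm,
      par_union (Finset.disjoint_singleton_right.2 hfT), par_singleton hf]
    funext w
    by_cases hwu : w = u
    · subst hwu
      simp [h1, huv, CharTwo.add_self_eq_zero]
    by_cases hwv : w = v
    · subst hwv
      simp [← huv', h1, hwu, CharTwo.add_self_eq_zero]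
    simp [hother w hwu hwv, hwu, hwv]

/-- A bridgeless edge set is covered by three even subsets (the `8`-flow theorem). -/
theorem exists_three_even (S : Finset G.E) (hS : ∀ e ∈ S, ∃ C ⊆ S, par C = 0 ∧ e ∈ C) :
    ∃ Z₁ ⊆ S, ∃ Z₂ ⊆ S, ∃ Z₃ ⊆ S, par Z₁ = 0 ∧ par Z₂ = 0 ∧ par Z₃ = 0 ∧
      S ⊆ Z₁ ∪ Z₂ ∪ Z₃ := by
  induction hn : S.card using Nat.strong_induction_on generalizing G with
  | _ n ih =>
  subst hn
  by_cases hsep : ∀ e ∈ S, ∀ f ∈ S, e ≠ f → ∃ C ⊆ S, par C = 0 ∧ ¬ (e ∈ C ↔ f ∈ C)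
  · exact exists_three_even_of_separated hS hsep
  push Not at hsep
  obtain ⟨e, he, f, hf, hef, hsame⟩ := hsep
  replace hsame : ∀ C ⊆ S, par C = 0 → (e ∈ C ↔ f ∈ C) := by
    intro C hC hp
    have := hsame C hC hp
    tauto
  obtain ⟨u, v, huv⟩ := exists_ends f
  have hne : u ≠ v := by
    rintro rfl
    have := hsame {f} (by simpa using hf) (by rw [par_singleton huv]; exact vec_add_self _)
    simp [hef] at this
  have hlift : ∀ T : Finset G.E, T ⊆ S.erase f →
      par (G := G.identify (Function.update id v u)) T = 0 →
      ∃ T' ⊆ S, par T' = 0 ∧ T ⊆ T' := by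
    intro T hT hp
    have hTS := hT.trans (Finset.erase_subset _ _)
    rcases exists_lift_of_par_identify huv hne
      (fun h => Finset.notMem_erase f S (hT h)) hp with h | h
    · exact ⟨T, hTS, h, subset_rfl⟩
    · exact ⟨_, Finset.insert_subset hf hTS, h, Finset.subset_insert _ _⟩
  obtain ⟨Z₁, h1, Z₂, h2, Z₃, h3, hp1, hp2, hp3, hcov⟩ :=
    ih (S.erase f).card (Finset.card_erase_lt_of_mem hf)
      (G := G.identify (Function.update id v u)) (S.erase f) (by
        intro e he
        obtain ⟨C, hC, hp, heC⟩ := hS e (Finset.erase_subset _ _ he)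
        refine ⟨C.erase f, Finset.erase_subset_erase _ hC, ?_,
          Finset.mem_erase.2 ⟨Finset.ne_of_mem_erase he, heC⟩⟩
        have hp' := par_identify_of_par hp (Function.update id v u)
        by_cases hfC : f ∈ C
        · have : par (G := G.identify (Function.update id v u)) (C \ {f}) = 0 := by
            rw [par_sdiff (by simpa using hfC), hp', par_identify_singleton huv, add_zero]
          rwa [Finset.sdiff_singleton_eq_erase] at this
        · rwa [Finset.erase_eq_of_notMem hfC]) rfl
  obtain ⟨T₁, hT1, hq1, hs1⟩ := hlift Z₁ h1 hp1
  obtain ⟨T₂, hT2, hq2, hs2⟩ := hlift Z₂ h2 hp2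
  obtain ⟨T₃, hT3, hq3, hs3⟩ := hlift Z₃ h3 hp3
  have hcov' : S.erase f ⊆ T₁ ∪ T₂ ∪ T₃ :=
    hcov.trans (Finset.union_subset_union (Finset.union_subset_union hs1 hs2) hs3)
  refine ⟨T₁, hT1, T₂, hT2, T₃, hT3, hq1, hq2, hq3, fun x hx => ?_⟩
  by_cases hxf : x = f
  · subst hxf
    have := hcov' (Finset.mem_erase.2 ⟨hef, he⟩)
    have i1 := hsame T₁ hT1 hq1
    have i2 := hsame T₂ hT2 hq2
    have i3 := hsame T₃ hT3 hq3
    simp only [Finset.mem_union] at this ⊢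
    rwa [← i1, ← i2, ← i3]
  · exact hcov' (Finset.mem_erase.2 ⟨hxf, hx⟩)

lemma connOn_of_reach {S : Finset G.E} (x : G.V) (h : ∀ u ∈ G.support S, G.Reach S x u) :
    G.ConnOn S := fun u hu v hv => (h u hu).symm.trans (h v hv)

lemma isPath_singleton {e : G.E} {u v : G.V} (h : G.ends e = s(u, v)) (huv : u ≠ v) :
    G.IsPath {e} u v := by
  have hs : ∀ w, w ∈ G.support {e} ↔ w = u ∨ w = v := by
    intro w
    simp [mem_support, h]
  refine ⟨by simp, ?_, huv, (hs u).2 (Or.inl rfl), (hs v).2 (Or.inr rfl), ?_, ?_, ?_⟩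
  · refine connOn_of_reach u fun w hw => ?_
    rcases (hs w).1 hw with rfl | rfl
    · exact Relation.ReflTransGen.refl
    · exact Reach.edge (by simp) h
  · simp [degIn_singleton h, huv.symm]
  · simp [degIn_singleton h, huv]
  · intro w hw hwu hwv
    rcases (hs w).1 hw with rfl | rfl
    · exact absurd rfl hwu
    · exact absurd rfl hwv

lemma IsPath.cons {P : Finset G.E} {e : G.E} {u w v : G.V} (h : G.ends e = s(u, w))
    (hP : G.IsPath P w v) (hu : u ∉ G.support P) : G.IsPath (insert e P) u v := by
  obtain ⟨h1, h2, h3, h4, h5, h6, h7, h8⟩ := hP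
  have huw : u ≠ w := fun hh => hu (hh ▸ h4)
  have huv : u ≠ v := fun hh => hu (hh ▸ h5)
  have he : e ∉ P := fun he => hu (mem_support.2 ⟨e, he, mem_ends_left h⟩)
  have hdeg : ∀ x, G.degIn (insert e P) x =
      ((if u = x then 1 else 0) + if w = x then 1 else 0) + G.degIn P x := by
    intro x
    rw [Finset.insert_eq, degIn_union (by simpa using he), degIn_singleton h]
  have hsup : ∀ x, x ∈ G.support (insert e P) ↔ x = u ∨ x ∈ G.support P := by
    intro x
    simp only [mem_support, Finset.mem_insert, exists_eq_or_imp, h, Sym2.mem_iff]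
    constructor
    · rintro ((rfl | rfl) | hx)
      · exact Or.inl rfl
      · exact Or.inr (mem_support.1 h4)
      · exact Or.inr hx
    · tauto
  have hu0 := degIn_eq_zero_iff.2 hu
  refine ⟨by simp, ?_, huv, (hsup u).2 (Or.inl rfl), (hsup v).2 (Or.inr h5), ?_, ?_, ?_⟩
  · refine connOn_of_reach u fun x hx => ?_
    rcases (hsup x).1 hx with rfl | hx
    · exact Relation.ReflTransGen.refl
    · exact (Reach.edge (Finset.mem_insert_self _ _) h).trans
        ((h2 w h4 x hx).mono (Finset.subset_insert _ _))
  · simp [hdeg, huw.symm, hu0]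
  · simp [hdeg, huv, h3, h7]
  · intro x hx hxu hxv
    have hx := ((hsup x).1 hx).resolve_left hxu
    rw [hdeg]
    by_cases hxw : x = w
    · subst hxw
      simp [huw, h6]
    · simp [Ne.symm hxu, Ne.symm hxw, h8 x hx hxw hxv]

lemma exists_isPath {S : Finset G.E} {u v : G.V} (h : G.Reach S u v) (huv : u ≠ v) :
    ∃ P ⊆ S, G.IsPath P u v := by
  induction hn : S.card using Nat.strong_induction_on generalizing S u with
  | _ n ih =>
  subst hn
  set T := S.filter fun e => u ∉ G.ends e with hT
  have key : ∀ x, G.Reach S x v → (x ≠ u ∧ G.Reach T x v) ∨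
      ∃ e ∈ S, ∃ w, w ≠ u ∧ G.ends e = s(u, w) ∧ G.Reach T w v := by
    intro x hx
    induction hx using Relation.ReflTransGen.head_induction_on with
    | refl => exact Or.inl ⟨huv.symm, Relation.ReflTransGen.refl⟩
    | @head a c hac _ ih =>
      rcases ih with ⟨hcu, hc⟩ | h
      · obtain ⟨e, he, hee⟩ := hac
        by_cases hau : a = u
        · subst hau
          exact Or.inr ⟨e, he, c, hcu, hee, hc⟩
        · refine Or.inl ⟨hau, (Reach.edge (Finset.mem_filter.2 ⟨he, ?_⟩) hee).trans hc⟩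
          rw [hee, Sym2.mem_iff]
          rintro (h | h)
          · exact hau h.symm
          · exact hcu h.symm
      · exact Or.inr h
  obtain ⟨e, he, w, hwu, hew, hw⟩ := (key u h).resolve_left fun h => h.1 rfl
  have hTS : T ⊆ S := Finset.filter_subset _ _
  by_cases hwv : w = v
  · subst hwv
    exact ⟨{e}, by simpa using he, isPath_singleton hew hwu.symm⟩
  · have hlt : T.card < S.card := by
      refine Finset.card_lt_card (Finset.ssubset_iff.2 ⟨e, ?_, Finset.insert_subset he hTS⟩)
      simp [hT, hew]
    obtain ⟨P, hPT, hP⟩ := ih _ hlt hw hwv rfl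
    refine ⟨insert e P, Finset.insert_subset he (hPT.trans hTS), hP.cons hew fun hu => ?_⟩
    obtain ⟨f, hf, huf⟩ := mem_support.1 hu
    exact (Finset.mem_filter.1 (hPT hf)).2 huf

lemma IsPath.par {P : Finset G.E} {u v : G.V} (h : G.IsPath P u v) :
    par P = Pi.single u 1 + Pi.single v 1 := by
  obtain ⟨h1, h2, h3, h4, h5, h6, h7, h8⟩ := h
  funext w
  by_cases hwu : w = u
  · subst hwu
    simp [SignedMultigraph.par, h6, h3]
  by_cases hwv : w = v
  · subst hwv
    simp [SignedMultigraph.par, h7, hwu]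
  by_cases hw : w ∈ G.support P
  · simp [SignedMultigraph.par, h8 w hw hwu hwv, hwu, hwv]
    decide
  · simp [par_eq_zero_of_notMem_support hw, hwu, hwv]

lemma IsCircuit.par {C : Finset G.E} (h : G.IsCircuit C) : par C = 0 := by
  funext w
  by_cases hw : w ∈ G.support C
  · simp [SignedMultigraph.par, h.2.2 w hw]
    decide
  · simp [par_eq_zero_of_notMem_support hw]

lemma isCircuit_union {p q : Finset G.E} {x y : G.V} (hp : G.IsPath p x y) (hq : G.IsPath q x y)
    (hd : Disjoint p q) (hs : G.support p ∩ G.support q ⊆ {x, y}) : G.IsCircuit (p ∪ q) := by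
  obtain ⟨p1, p2, p3, p4, p5, p6, p7, p8⟩ := hp
  obtain ⟨q1, q2, q3, q4, q5, q6, q7, q8⟩ := hq
  refine ⟨p1.mono Finset.subset_union_left, ?_, ?_⟩
  · refine connOn_of_reach x fun w hw => ?_
    rw [support_union, Finset.mem_union] at hw
    rcases hw with hw | hw
    · exact (p2 x p4 w hw).mono Finset.subset_union_left
    · exact (q2 x q4 w hw).mono Finset.subset_union_right
  · intro w hw
    rw [degIn_union hd]
    by_cases hwx : w = x
    · rw [hwx, p6, q6]
    by_cases hwy : w = y
    · rw [hwy, p7, q7]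
    have hn : ¬ (w ∈ G.support p ∧ w ∈ G.support q) := fun h => by
      have := hs (Finset.mem_inter.2 h)
      simp [hwx, hwy] at this
    rw [support_union, Finset.mem_union] at hw
    rcases hw with hw | hw
    · rw [p8 w hw hwx hwy, degIn_eq_zero_iff.2 fun h => hn ⟨hw, h⟩]
    · rw [q8 w hw hwx hwy, degIn_eq_zero_iff.2 fun h => hn ⟨h, hw⟩]

lemma isCircuit_loop {e : G.E} {u : G.V} (h : G.ends e = s(u, u)) : G.IsCircuit {e} := by
  have hs : ∀ w, w ∈ G.support {e} ↔ w = u := by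
    intro w
    simp [mem_support, h]
  refine ⟨by simp, ?_, ?_⟩
  · refine connOn_of_reach u fun w hw => ?_
    rw [(hs w).1 hw]
    exact Relation.ReflTransGen.refl
  · intro w hw
    rw [(hs w).1 hw, degIn_singleton h]
    simp

lemma reach_erase_of_even {Z : Finset G.E} (hZ : par Z = 0) {e : G.E} (he : e ∈ Z) {u v : G.V}
    (h : G.ends e = s(u, v)) : G.Reach (Z.erase e) u v := by
  by_contra hr
  refine boundary_ne_singleton hZ (comp (Z.erase e) u) e
    (Finset.eq_singleton_iff_unique_mem.2 ⟨?_, fun f hf => ?_⟩)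
  · rw [mem_boundary h]
    exact ⟨he, fun hh => hr (mem_comp.1 (hh.1 (self_mem_comp _ _)))⟩
  · by_contra hfe
    have := mem_boundary_of_subset hf (Finset.mem_erase.2 ⟨hfe, boundary_subset _ _ hf⟩)
    simp [boundary_comp] at this

lemma exists_circuit_mem {Z : Finset G.E} (hZ : par Z = 0) {e : G.E} (he : e ∈ Z) :
    ∃ C ⊆ Z, G.IsCircuit C ∧ e ∈ C := by
  obtain ⟨u, v, h⟩ := exists_ends e
  by_cases huv : u = v
  · subst huv
    exact ⟨{e}, by simpa using he, isCircuit_loop h, by simp⟩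
  · obtain ⟨P, hP, hpath⟩ := exists_isPath (reach_erase_of_even hZ he h) huv
    have heP : e ∉ P := fun h => Finset.notMem_erase e Z (hP h)
    refine ⟨P ∪ {e}, Finset.union_subset (hP.trans (Finset.erase_subset _ _)) (by simpa using he),
      isCircuit_union hpath (isPath_singleton h huv) (by simpa using heP) ?_, by simp⟩
    intro w hw
    obtain ⟨f, hf, hwf⟩ := mem_support.1 (Finset.mem_inter.1 hw).2
    rw [Finset.mem_singleton] at hf
    subst hf
    rw [h, Sym2.mem_iff] at hwf
    simpa using hwf

lemma IsCircuit.eq_of_even_subset {C D : Finset G.E} (hC : G.IsCircuit C) (hD : D ⊆ C)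
    (hne : D.Nonempty) (hp : SignedMultigraph.par D = 0) : D = C := by
  have hall : ∀ v ∈ G.support D, ∀ e ∈ C, v ∈ G.ends e → e ∈ D := by
    intro v hv e he hve
    by_contra heD
    have h1 : Even (G.degIn D v) := by
      rw [← ZMod.natCast_eq_zero_iff_even]
      exact congrFun hp v
    have h2 : G.degIn D v ≠ 0 := fun h => degIn_eq_zero_iff.1 h hv
    have h3 := degIn_union (Finset.disjoint_sdiff (s := D) (t := C)) v
    rw [Finset.union_sdiff_of_subset hD, hC.2.2 v (support_mono hD hv)] at h3
    have h4 : G.degIn (C \ D) v ≠ 0 := fun h =>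
      degIn_eq_zero_iff.1 h (mem_support.2 ⟨e, Finset.mem_sdiff.2 ⟨he, heD⟩, hve⟩)
    obtain ⟨k, hk⟩ := h1
    omega
  refine hD.antisymm fun e he => ?_
  obtain ⟨f, hf⟩ := hne
  obtain ⟨a, b, hab⟩ := exists_ends f
  obtain ⟨c, d, hcd⟩ := exists_ends e
  have ha : a ∈ G.support D := mem_support.2 ⟨f, hf, mem_ends_left hab⟩
  have hr := hC.2.1 a (support_mono hD ha) c (mem_support.2 ⟨e, he, mem_ends_left hcd⟩)
  have hc : c ∈ G.support D := by
    clear hcd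
    induction hr with
    | refl => exact ha
    | @tail x y _ hxy ih =>
      obtain ⟨g, hg, hg'⟩ := hxy
      exact mem_support.2 ⟨g, hall x ih g hg (mem_ends_left hg'), mem_ends_right hg'⟩
  exact hall c hc e he (mem_ends_left hcd)

lemma exists_circuit_decomposition {Z : Finset G.E} (hZ : par Z = 0) :
    ∃ 𝒟 : Finset (Finset G.E), (∀ D ∈ 𝒟, G.IsCircuit D) ∧
      (∀ D ∈ 𝒟, ∀ D' ∈ 𝒟, D ≠ D' → Disjoint D D') ∧ 𝒟.biUnion id = Z := by
  induction hn : Z.card using Nat.strong_induction_on generalizing Z with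
  | _ n ih =>
  subst hn
  rcases Z.eq_empty_or_nonempty with rfl | ⟨e, he⟩
  · exact ⟨∅, by simp, by simp, by simp⟩
  obtain ⟨C, hCZ, hC, heC⟩ := exists_circuit_mem hZ he
  obtain ⟨𝒟, h1, h2, h3⟩ := ih (Z \ C).card
    (Finset.card_lt_card (Finset.sdiff_ssubset hCZ ⟨e, heC⟩))
    (by rw [par_sdiff hCZ, hZ, hC.par, add_zero]) rfl
  have hdis : ∀ D ∈ 𝒟, Disjoint C D := fun D hD =>
    Finset.disjoint_sdiff.mono_right (h3 ▸ Finset.subset_biUnion_of_mem id hD)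
  refine ⟨insert C 𝒟, ?_, ?_, ?_⟩
  · intro D hD
    rcases Finset.mem_insert.1 hD with rfl | hD
    · exact hC
    · exact h1 D hD
  · intro D hD D' hD' hne
    rw [Finset.mem_insert] at hD hD'
    rcases hD with h | h <;> rcases hD' with h' | h'
    · exact absurd (h.trans h'.symm) hne
    · exact h ▸ hdis D' h'
    · exact h' ▸ (hdis D h).symm
    · exact h2 D h D' h' hne
  · rw [Finset.biUnion_insert, h3, id, Finset.union_sdiff_of_subset hCZ]

/-- Two vertices of a circuit split it into two internally disjoint paths. -/
lemma IsCircuit.exists_paths {C : Finset G.E} (hC : G.IsCircuit C) {x y : G.V}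
    (hx : x ∈ G.support C) (hy : y ∈ G.support C) (hxy : x ≠ y) :
    ∃ p ⊆ C, G.IsPath p x y ∧ G.IsPath (C \ p) x y := by
  obtain ⟨p, hpC, hp⟩ := exists_isPath (hC.2.1 x hx y hy) hxy
  refine ⟨p, hpC, hp, ?_⟩
  have hpar : SignedMultigraph.par (C \ p) = Pi.single x 1 + Pi.single y 1 := by
    rw [par_sdiff hpC, hC.par, hp.par, zero_add]
  have hdeg : ∀ v ∈ G.support C, G.degIn (C \ p) v + G.degIn p v = 2 := by
    intro v hv
    rw [← degIn_union Finset.sdiff_disjoint, Finset.sdiff_union_of_subset hpC, hC.2.2 v hv]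
  obtain ⟨p1, p2, p3, p4, p5, p6, p7, p8⟩ := hp
  have dx : G.degIn (C \ p) x = 1 := by have := hdeg x hx; omega
  have dy : G.degIn (C \ p) y = 1 := by have := hdeg y hy; omega
  have sx : x ∈ G.support (C \ p) := by
    by_contra h
    rw [degIn_eq_zero_iff.2 h] at dx
    omega
  have sy : y ∈ G.support (C \ p) := by
    by_contra h
    rw [degIn_eq_zero_iff.2 h] at dy
    omega
  set X := comp (C \ p) x with hX
  have hyX : y ∈ X := by
    by_contra hyX
    have h1 := sum_par (C \ p) X
    rw [boundary_comp, Finset.card_empty, hpar] at h1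
    have hxX : x ∈ X := self_mem_comp _ _
    simp [Finset.sum_add_distrib, Pi.single_apply, hyX, hxX] at h1
  refine ⟨?_, ?_, hxy, sx, sy, dx, dy, ?_⟩
  · obtain ⟨e, he, -⟩ := mem_support.1 sx
    exact ⟨e, he⟩
  · refine connOn_of_reach x fun v hv => ?_
    by_contra hvX
    have hYb : G.boundary (C \ p) Xᶜ = ∅ := by
      ext e
      obtain ⟨a, b, h⟩ := exists_ends e
      have := Finset.ext_iff.1 (boundary_comp (C \ p) x) e
      rw [mem_boundary h] at this ⊢
      simp only [Finset.mem_compl, Finset.notMem_empty, iff_false] at this ⊢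
      tauto
    have heven : SignedMultigraph.par (within (C \ p) Xᶜ) = 0 := by
      refine par_within_eq_zero hYb fun w hw => ?_
      have hwx : w ≠ x := by
        rintro rfl
        exact Finset.mem_compl.1 hw (self_mem_comp _ _)
      have hwy : w ≠ y := by
        rintro rfl
        exact Finset.mem_compl.1 hw hyX
      simp [hpar, hwx, hwy]
    obtain ⟨e, he, hve⟩ := mem_support.1 hv
    have hmem : e ∈ within (C \ p) Xᶜ :=
      mem_within_of_mem hYb he hve (Finset.mem_compl.2 fun h => hvX (mem_comp.1 h))
    have hsub : within (C \ p) Xᶜ ⊆ C \ p := within_subset _ _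
    have := hC.eq_of_even_subset (hsub.trans Finset.sdiff_subset) ⟨e, hmem⟩ heven
    obtain ⟨f, hf⟩ := p1
    exact (Finset.mem_sdiff.1 (hsub (this.ge (hpC hf)))).2 hf
  · intro w hw hwx hwy
    have h1 := hdeg w (support_mono Finset.sdiff_subset hw)
    have h2 : G.degIn (C \ p) w ≠ 0 := fun h => degIn_eq_zero_iff.1 h hw
    by_cases hwp : w ∈ G.support p
    · have := p8 w hwp hwx hwy
      omega
    · have := degIn_eq_zero_iff.2 hwp
      omega

lemma card_negEdges_union {S T : Finset G.E} (h : Disjoint S T) :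
    (G.negEdges (S ∪ T)).card = (G.negEdges S).card + (G.negEdges T).card := by
  rw [negEdges, Finset.filter_union, Finset.card_union_of_disjoint]
  · rfl
  · exact Finset.disjoint_filter_filter h

/-- A shortest connection between the vertex sets `X` and `Y` inside `Q` meets `X ∪ Y` only in its
ends. -/
lemma exists_path_between {Q : Finset G.E} {X Y : Finset G.V}
    (h : ∃ x ∈ X, ∃ y ∈ Y, x ≠ y ∧ G.Reach Q x y) :
    ∃ p ⊆ Q, ∃ x ∈ X, ∃ y ∈ Y, G.IsPath p x y ∧
      (∀ w ∈ G.support p, w ∈ X → w ≠ x → w = y) ∧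
      ∀ w ∈ G.support p, w ∈ Y → w ≠ y → w = x := by
  obtain ⟨x₀, hx₀, y₀, hy₀, hne, hr⟩ := h
  obtain ⟨p₀, hp₀Q, hp₀⟩ := exists_isPath hr hne
  obtain ⟨p, hp, hmin⟩ := Finset.exists_min_image
    (Q.powerset.filter fun p => ∃ x ∈ X, ∃ y ∈ Y, G.IsPath p x y) Finset.card
    ⟨p₀, Finset.mem_filter.2 ⟨Finset.mem_powerset.2 hp₀Q, x₀, hx₀, y₀, hy₀, hp₀⟩⟩
  rw [Finset.mem_filter, Finset.mem_powerset] at hp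
  obtain ⟨hpQ, x, hx, y, hy, hpath⟩ := hp
  have hsub : ∀ u ∈ G.support p, ∀ v ∈ G.support p, u ≠ v → u ∈ X → v ∈ Y →
      ∃ q, G.IsPath q u v ∧ q = p := by
    intro u hu v hv huv huX hvY
    obtain ⟨q, hqp, hq⟩ := exists_isPath (hpath.2.1 u hu v hv) huv
    refine ⟨q, hq, Finset.eq_of_subset_of_card_le hqp (hmin q ?_)⟩
    exact Finset.mem_filter.2 ⟨Finset.mem_powerset.2 (hqp.trans hpQ), u, huX, v, hvY, hq⟩
  obtain ⟨p1, p2, p3, p4, p5, p6, p7, p8⟩ := hpath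
  refine ⟨p, hpQ, x, hx, y, hy, ⟨p1, p2, p3, p4, p5, p6, p7, p8⟩, ?_, ?_⟩
  · intro w hw hwX hwx
    by_contra hwy
    obtain ⟨q, hq, rfl⟩ := hsub w hw y p5 hwy hwX hy
    have := hq.2.2.2.2.2.2.2 x p4 hwx.symm p3
    omega
  · intro w hw hwY hwy
    by_contra hwx
    obtain ⟨q, hq, rfl⟩ := hsub x p4 w hw (Ne.symm hwx) hx hwY
    have := hq.2.2.2.2.2.2.2 y p5 p3.symm hwy.symm
    omega

/-- Two edge-disjoint unbalanced circuits with two common vertices contain a balanced circuit. -/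
lemma exists_balanced_of_common {D D' : Finset G.E} (hD : G.IsUnbalancedCircuit D)
    (hD' : G.IsCircuit D') (hdisj : Disjoint D D') {x₀ y₀ : G.V} (hne : x₀ ≠ y₀)
    (hx : x₀ ∈ G.support D ∩ G.support D') (hy : y₀ ∈ G.support D ∩ G.support D') :
    ∃ C ⊆ D ∪ D', G.IsBalancedCircuit C := by
  rw [Finset.mem_inter] at hx hy
  obtain ⟨q, hqD', x, hxD, y, hyD, hq, hmeet, -⟩ := exists_path_between (Q := D')
    (X := G.support D) (Y := G.support D)
    ⟨x₀, hx.1, y₀, hy.1, hne, hD'.2.1 _ hx.2 _ hy.2⟩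
  obtain ⟨p, hpD, hp, hp'⟩ := hD.1.exists_paths hxD hyD hq.2.2.1
  have hs : ∀ r ⊆ D, G.support r ∩ G.support q ⊆ {x, y} := by
    intro r hr w hw
    rw [Finset.mem_inter] at hw
    by_cases hwx : w = x
    · simp [hwx]
    · simp [hmeet w hw.2 (support_mono hr hw.1) hwx]
  have hd : ∀ r ⊆ D, Disjoint r q := fun r hr => hdisj.mono hr hqD'
  have h1 := isCircuit_union hp hq (hd p hpD) (hs p hpD)
  have h2 := isCircuit_union hp' hq (hd _ Finset.sdiff_subset) (hs _ Finset.sdiff_subset)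
  have hn := hD.2
  have hcard := card_negEdges_union (Finset.disjoint_sdiff (s := p) (t := D))
  rw [Finset.union_sdiff_of_subset hpD] at hcard
  by_cases hb : Even (G.negEdges (p ∪ q)).card
  · exact ⟨p ∪ q, Finset.union_subset_union hpD hqD', h1, hb⟩
  · refine ⟨D \ p ∪ q, Finset.union_subset_union Finset.sdiff_subset hqD', h2, ?_⟩
    rw [card_negEdges_union (hd p hpD)] at hb
    rw [card_negEdges_union (hd _ Finset.sdiff_subset)]
    rw [hcard] at hn
    rw [Nat.even_add] at *
    tauto

lemma exists_barbell {D D' Q : Finset G.E} (hD : G.IsUnbalancedCircuit D)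
    (hD' : G.IsUnbalancedCircuit D') (hdisj : Disjoint D D')
    (hno : ¬ ∃ C ⊆ D ∪ D', G.IsBalancedCircuit C) {v v' : G.V} (hv : v ∈ G.support D)
    (hv' : v' ∈ G.support D') (hr : G.Reach Q v v') :
    ∃ S, G.IsSignedCircuit S ∧ D ∪ D' ⊆ S ∧ S ⊆ D ∪ D' ∪ Q ∧ G.ConnOn S := by
  by_cases hmeet : ∃ x, x ∈ G.support D ∩ G.support D'
  · obtain ⟨x, hx⟩ := hmeet
    refine ⟨D ∪ D', Or.inr (Or.inl ⟨D, D', hD, hD', hdisj, ?_, rfl⟩), subset_rfl,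
      Finset.subset_union_left, ?_⟩
    · rw [Finset.card_eq_one]
      refine ⟨x, Finset.eq_singleton_iff_unique_mem.2 ⟨hx, fun y hy => ?_⟩⟩
      by_contra hxy
      exact hno (exists_balanced_of_common hD hD'.1 hdisj hxy hy hx)
    · rw [Finset.mem_inter] at hx
      refine connOn_of_reach x fun w hw => ?_
      rw [support_union, Finset.mem_union] at hw
      rcases hw with hw | hw
      · exact (hD.1.2.1 x hx.1 w hw).mono Finset.subset_union_left
      · exact (hD'.1.2.1 x hx.2 w hw).mono Finset.subset_union_right
  · push Not at hmeet
    have hvd : Disjoint (G.support D) (G.support D') :=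
      Finset.disjoint_iff_inter_eq_empty.2 (Finset.eq_empty_of_forall_notMem hmeet)
    have hne : ∀ {a b}, a ∈ G.support D → b ∈ G.support D' → a ≠ b := by
      rintro a b ha hb rfl
      exact Finset.disjoint_left.1 hvd ha hb
    obtain ⟨p, hpQ, x, hx, y, hy, hp, hpx, hpy⟩ := exists_path_between (Q := Q)
      ⟨v, hv, v', hv', hne hv hv', hr⟩
    have hpD : ∀ w, w ∈ G.support p → w ∈ G.support D → w = x := by
      intro w hw hwD
      by_contra hwx
      exact hne hwD hy (hpx w hw hwD hwx)
    have hpD' : ∀ w, w ∈ G.support p → w ∈ G.support D' → w = y := by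
      intro w hw hwD
      by_contra hwy
      exact hne hx hwD (hpy w hw hwD hwy).symm
    have hloop : ∀ (R : Finset G.E) (z : G.V), G.degIn p z = 1 →
        (∀ w, w ∈ G.support p → w ∈ G.support R → w = z) → Disjoint p R := by
      intro R z hz hR
      refine Finset.disjoint_left.2 fun e he heR => ?_
      obtain ⟨a, b, hab⟩ := exists_ends e
      have ha := hR a (mem_support.2 ⟨e, he, mem_ends_left hab⟩)
        (mem_support.2 ⟨e, heR, mem_ends_left hab⟩)
      have hb := hR b (mem_support.2 ⟨e, he, mem_ends_right hab⟩)
        (mem_support.2 ⟨e, heR, mem_ends_right hab⟩)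
      have h1 := degIn_mono (Finset.singleton_subset_iff.2 he) z
      rw [degIn_singleton hab, hz, ha, hb] at h1
      simp at h1
    obtain ⟨p1, p2, p3, p4, p5, p6, p7, p8⟩ := hp
    refine ⟨D ∪ D' ∪ p, Or.inr (Or.inr ⟨D, D', p, x, y, hD, hD', hvd,
      ⟨p1, p2, p3, p4, p5, p6, p7, p8⟩, ?_, ?_, hloop D x p6 hpD, hloop D' y p7 hpD', rfl⟩),
      Finset.subset_union_left, Finset.union_subset_union subset_rfl hpQ, ?_⟩
    · refine Finset.eq_singleton_iff_unique_mem.2 ⟨Finset.mem_inter.2 ⟨p4, hx⟩, fun w hw => ?_⟩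
      rw [Finset.mem_inter] at hw
      exact hpD w hw.1 hw.2
    · refine Finset.eq_singleton_iff_unique_mem.2 ⟨Finset.mem_inter.2 ⟨p5, hy⟩, fun w hw => ?_⟩
      rw [Finset.mem_inter] at hw
      exact hpD' w hw.1 hw.2
    · have hxy : G.Reach (D ∪ D' ∪ p) x y := (p2 x p4 y p5).mono Finset.subset_union_right
      refine connOn_of_reach x fun w hw => ?_
      rw [support_union, support_union, Finset.mem_union, Finset.mem_union] at hw
      rcases hw with (hw | hw) | hw
      · exact (hD.1.2.1 x hx w hw).mono
          (Finset.subset_union_left.trans Finset.subset_union_left)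
      · exact hxy.trans ((hD'.1.2.1 y hy w hw).mono
          (Finset.subset_union_right.trans Finset.subset_union_left))
      · exact (p2 x p4 w hw).mono Finset.subset_union_right

/-- A family of edge sets covers the edge `e`. -/
def Covers (F : Multiset (Finset G.E)) (e : G.E) : Prop := ∃ S ∈ F, e ∈ S

lemma coverLength_add (F F' : Multiset (Finset G.E)) :
    G.coverLength (F + F') = G.coverLength F + G.coverLength F' := by
  simp [coverLength]

lemma coverLength_cons (S : Finset G.E) (F : Multiset (Finset G.E)) :
    G.coverLength (S ::ₘ F) = S.card + G.coverLength F := by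
  simp [coverLength]

/-- An even set of positive edges decomposes into balanced circuits. -/
lemma exists_cover_of_even_positive {Z : Finset G.E} (hZ : par Z = 0)
    (hpos : ∀ e ∈ Z, G.neg e = false) :
    ∃ F : Multiset (Finset G.E), (∀ S ∈ F, G.IsSignedCircuit S) ∧ (∀ e ∈ Z, Covers F e) ∧
      G.coverLength F = Z.card := by
  obtain ⟨𝒟, h1, h2, h3⟩ := exists_circuit_decomposition hZ
  refine ⟨𝒟.val, fun D hD => Or.inl ⟨h1 D hD, ?_⟩, fun e he => ?_, ?_⟩
  · have : G.negEdges D = ∅ := by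
      refine Finset.filter_eq_empty_iff.2 fun e he => ?_
      rw [hpos e (h3 ▸ Finset.mem_biUnion.2 ⟨D, hD, he⟩)]
      simp
    simp [this]
  · rw [← h3, Finset.mem_biUnion] at he
    exact he
  · rw [← h3, Finset.card_biUnion]
    · rfl
    · exact fun D hD D' hD' hne => h2 D hD D' hD' hne

/-- A bridgeless set of positive edges has a cover of at most `5/2` times its size. -/
lemma exists_cover_of_bridgeless {S : Finset G.E} (hpos : ∀ e ∈ S, G.neg e = false)
    (hS : ∀ e ∈ S, ∃ C ⊆ S, par C = 0 ∧ e ∈ C) :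
    ∃ F : Multiset (Finset G.E), (∀ T ∈ F, G.IsSignedCircuit T) ∧ (∀ e ∈ S, Covers F e) ∧
      2 * G.coverLength F ≤ 5 * S.card := by
  have hfam : ∀ Z₁ ⊆ S, ∀ Z₂ ⊆ S, ∀ Z₃ ⊆ S, par Z₁ = 0 → par Z₂ = 0 → par Z₃ = 0 →
      S ⊆ Z₁ ∪ Z₂ ∪ Z₃ → ∃ F : Multiset (Finset G.E), (∀ T ∈ F, G.IsSignedCircuit T) ∧
        (∀ e ∈ S, Covers F e) ∧ G.coverLength F = Z₁.card + Z₂.card + Z₃.card := by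
    intro Z₁ h1 Z₂ h2 Z₃ h3 p1 p2 p3 hcov
    obtain ⟨F₁, a1, b1, c1⟩ := exists_cover_of_even_positive p1 fun e he => hpos e (h1 he)
    obtain ⟨F₂, a2, b2, c2⟩ := exists_cover_of_even_positive p2 fun e he => hpos e (h2 he)
    obtain ⟨F₃, a3, b3, c3⟩ := exists_cover_of_even_positive p3 fun e he => hpos e (h3 he)
    refine ⟨F₁ + F₂ + F₃, ?_, ?_, by rw [coverLength_add, coverLength_add, c1, c2, c3]⟩
    · intro T hT
      rw [Multiset.mem_add, Multiset.mem_add] at hT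
      rcases hT with (h | h) | h
      exacts [a1 T h, a2 T h, a3 T h]
    · intro e he
      have := hcov he
      rw [Finset.mem_union, Finset.mem_union] at this
      simp only [Covers, Multiset.mem_add]
      rcases this with (h | h) | h
      · obtain ⟨T, hT, heT⟩ := b1 e h
        exact ⟨T, Or.inl (Or.inl hT), heT⟩
      · obtain ⟨T, hT, heT⟩ := b2 e h
        exact ⟨T, Or.inl (Or.inr hT), heT⟩
      · obtain ⟨T, hT, heT⟩ := b3 e h
        exact ⟨T, Or.inr hT, heT⟩
  obtain ⟨Z₁, h1, Z₂, h2, Z₃, h3, p1, p2, p3, hcov⟩ := exists_three_even S hS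
  have h12 : Z₁ ∆ Z₂ ⊆ S := by
    intro e he
    rw [Finset.mem_symmDiff] at he
    exact he.elim (fun h => h1 h.1) fun h => h2 h.1
  obtain ⟨F, a, b, c⟩ := hfam Z₁ h1 Z₂ h2 Z₃ h3 p1 p2 p3 hcov
  obtain ⟨F', a', b', c'⟩ := hfam (Z₁ ∆ Z₂) h12 Z₂ h2 Z₃ h3
    (by rw [par_symmDiff, p1, p2, add_zero]) p2 p3 (by
      intro e he
      have := hcov he
      simp only [Finset.mem_union, Finset.mem_symmDiff] at this ⊢
      tauto)
  have hsum : (Z₁ ∆ Z₂).card + Z₁.card + Z₂.card ≤ 2 * S.card := by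
    have k1 : (Z₁ ∆ Z₂).card = (Z₁ \ Z₂).card + (Z₂ \ Z₁).card := by
      rw [symmDiff_def, Finset.sup_eq_union, Finset.card_union_of_disjoint disjoint_sdiff_sdiff]
    have k2 := Finset.card_sdiff_add_card_inter Z₁ Z₂
    have k3 := Finset.card_sdiff_add_card_inter Z₂ Z₁
    have k4 := Finset.card_union_add_card_inter Z₁ Z₂
    have k5 := Finset.card_le_card (Finset.union_subset h1 h2)
    rw [Finset.inter_comm] at k3
    omega
  have l2 := Finset.card_le_card h2
  have l3 := Finset.card_le_card h3
  by_cases hle : 2 * G.coverLength F ≤ 5 * S.card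
  · exact ⟨F, a, b, hle⟩
  · exact ⟨F', a', b', by omega⟩

/-- The edges of `S` lying in some even subset of `S`, that is, the non-bridges of `S`. -/
def core (S : Finset G.E) : Finset G.E := S.filter fun e => ∃ C ⊆ S, par C = 0 ∧ e ∈ C

lemma core_subset (S : Finset G.E) : core S ⊆ S := Finset.filter_subset _ _

lemma core_bridgeless (S : Finset G.E) :
    ∀ e ∈ core S, ∃ C ⊆ core S, par C = 0 ∧ e ∈ C := by
  intro e he
  obtain ⟨C, hC, hp, heC⟩ := (Finset.mem_filter.1 he).2
  exact ⟨C, fun f hf => Finset.mem_filter.2 ⟨hC hf, C, hC, hp, hf⟩, hp, heC⟩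

/-- A join can be chosen to use at most half of the non-bridges. -/
lemma exists_small_join {S K₀ : Finset G.E} (hK₀ : K₀ ⊆ S) :
    ∃ K ⊆ S, par K = par K₀ ∧ 2 * K.card ≤ (core S).card + 2 * (S \ core S).card := by
  set 𝒦 := S.powerset.filter fun K => par K = par K₀ with h𝒦
  have hmem : ∀ K, K ∈ 𝒦 ↔ K ⊆ S ∧ par K = par K₀ := by simp [h𝒦]
  have hhalf : ∀ e ∈ core S, 2 * (𝒦.filter fun K => e ∈ K).card = 𝒦.card := by
    intro e he
    obtain ⟨C, hC, hp, heC⟩ := (Finset.mem_filter.1 he).2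
    have hinv : ∀ K ∈ 𝒦, K ∆ C ∈ 𝒦 := by
      intro K hK
      rw [hmem] at hK ⊢
      refine ⟨fun x hx => ?_, by rw [par_symmDiff, hK.2, hp, add_zero]⟩
      rw [Finset.mem_symmDiff] at hx
      exact hx.elim (fun h => hK.1 h.1) fun h => hC h.1
    have hbij : (𝒦.filter fun K => e ∈ K).card = (𝒦.filter fun K => e ∉ K).card := by
      refine Finset.card_bij (fun K _ => K ∆ C) ?_ ?_ ?_
      · intro K hK
        rw [Finset.mem_filter] at hK ⊢
        exact ⟨hinv K hK.1, by simp [Finset.mem_symmDiff, hK.2, heC]⟩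
      · intro K _ K' _ h
        exact symmDiff_left_injective C h
      · intro K hK
        rw [Finset.mem_filter] at hK
        refine ⟨K ∆ C, Finset.mem_filter.2 ⟨hinv K hK.1, ?_⟩, symmDiff_symmDiff_cancel_right _ _⟩
        simp [Finset.mem_symmDiff, hK.2, heC]
    have := Finset.card_filter_add_card_filter_not (s := 𝒦) (fun K => e ∈ K)
    omega
  have hsum : ∑ K ∈ 𝒦, 2 * (K ∩ core S).card = ∑ K ∈ 𝒦, (core S).card := by
    have h1 : ∀ K, (K ∩ core S).card = ∑ e ∈ core S, if e ∈ K then 1 else 0 := by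
      intro K
      rw [Finset.inter_comm, ← Finset.filter_mem_eq_inter, Finset.card_filter]
    simp only [h1]
    rw [← Finset.mul_sum, Finset.sum_comm]
    simp only [← Finset.card_filter]
    rw [Finset.mul_sum, Finset.sum_congr rfl hhalf]
    simp [mul_comm]
  obtain ⟨K, hK, hle⟩ := Finset.exists_le_of_sum_le ⟨K₀, (hmem _).2 ⟨hK₀, rfl⟩⟩ hsum.le
  rw [hmem] at hK
  refine ⟨K, hK.1, hK.2, ?_⟩
  have h1 := Finset.card_inter_add_card_sdiff K (core S)
  have h2 := Finset.card_le_card (Finset.sdiff_subset_sdiff hK.1 (subset_refl (core S)))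
  omega

/-- The number of negative edges of `S` inside `A`. -/
def negIn (S : Finset G.E) (A : Finset G.V) : ℕ := (G.negEdges (within S A)).card

lemma within_union (S T : Finset G.E) (A : Finset G.V) :
    within (S ∪ T) A = within S A ∪ within T A := Finset.filter_union _ _ _

lemma negIn_union {S T : Finset G.E} (h : Disjoint S T) (A : Finset G.V) :
    negIn (S ∪ T) A = negIn S A + negIn T A := by
  rw [negIn, within_union, card_negEdges_union]
  · rfl
  · exact h.mono (within_subset _ _) (within_subset _ _)

lemma within_eq_of_connOn {S : Finset G.E} (hS : G.ConnOn S) {A : Finset G.V}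
    (hA : G.boundary S A = ∅) {v : G.V} (hv : v ∈ G.support S) :
    (v ∈ A → within S A = S) ∧ (v ∉ A → within S A = ∅) := by
  constructor
  · intro hvA
    refine (within_subset _ _).antisymm fun e he => Finset.mem_filter.2 ⟨he, fun u hu => ?_⟩
    exact (Reach.mem_iff hA (hS v hv u (mem_support.2 ⟨e, he, hu⟩))).1 hvA
  · intro hvA
    refine Finset.eq_empty_of_forall_notMem fun e he => hvA ?_
    obtain ⟨a, b, h⟩ := exists_ends e
    rw [mem_within h] at he
    exact (Reach.mem_iff hA (hS v hv a (mem_support.2 ⟨e, he.1, mem_ends_left h⟩))).2 he.2.1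

lemma even_negIn_of_connOn {S : Finset G.E} (hS : G.ConnOn S) (heven : Even (G.negEdges S).card)
    {A : Finset G.V} (hA : G.boundary S A = ∅) : Even (negIn S A) := by
  rcases S.eq_empty_or_nonempty with rfl | ⟨e, he⟩
  · simp [negIn, within, negEdges]
  obtain ⟨a, b, h⟩ := exists_ends e
  have hw := within_eq_of_connOn hS hA (mem_support.2 ⟨e, he, mem_ends_left h⟩)
  rw [negIn]
  by_cases ha : a ∈ A
  · rwa [hw.1 ha]
  · simp [hw.2 ha, negEdges]

lemma mem_of_odd_negIn {S : Finset G.E} (hS : G.ConnOn S) (heven : Even (G.negEdges S).card)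
    {A : Finset G.V} {b : G.E} (hA : G.boundary Finset.univ A = {b}) (hodd : ¬ Even (negIn S A)) :
    b ∈ S := by
  by_contra hb
  refine hodd (even_negIn_of_connOn hS heven (Finset.eq_empty_of_forall_notMem fun e he => ?_))
  have := boundary_mono (Finset.subset_univ S) A he
  rw [hA, Finset.mem_singleton] at this
  exact hb (this ▸ boundary_subset _ _ he)

lemma exists_reach_join {K : Finset G.E} {u v : G.V} (h : G.Reach K u v) :
    ∃ Q ⊆ K, G.Reach Q u v ∧ par Q = Pi.single u 1 + Pi.single v 1 := by
  by_cases huv : u = v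
  · subst huv
    exact ⟨∅, by simp, Relation.ReflTransGen.refl, by rw [par_empty]; exact (vec_add_self _).symm⟩
  · obtain ⟨Q, hQ, hp⟩ := exists_isPath h huv
    exact ⟨Q, hQ, hp.2.1 u hp.2.2.2.1 v hp.2.2.2.2.1, hp.par⟩

/-- Unbalanced circuits are paired up into barbells along a join of chosen vertices. -/
lemma exists_pairing (𝒟 : Finset (Finset G.E)) (v : Finset G.E → G.V) (K : Finset G.E)
    (h𝒟 : ∀ D ∈ 𝒟, G.IsUnbalancedCircuit D ∧ v D ∈ G.support D)
    (hdisj : ∀ D ∈ 𝒟, ∀ D' ∈ 𝒟, D ≠ D' → Disjoint D D')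
    (hno : ¬ ∃ C ⊆ 𝒟.biUnion id, G.IsBalancedCircuit C) (hK : ∀ e ∈ K, G.neg e = false)
    (hpar : par K = ∑ D ∈ 𝒟, Pi.single (v D) 1) :
    ∃ F : Multiset (Finset G.E), (∀ S ∈ F, G.IsSignedCircuit S) ∧
      (∀ D ∈ 𝒟, ∀ e ∈ D, Covers F e) ∧
      (∀ A b, G.boundary Finset.univ A = {b} → ¬ Even (∑ D ∈ 𝒟, negIn D A) → Covers F b) ∧
      G.coverLength F ≤ ∑ D ∈ 𝒟, D.card + K.card := by
  induction hn : 𝒟.card using Nat.strong_induction_on generalizing 𝒟 K with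
  | _ n ih =>
  subst hn
  rcases 𝒟.eq_empty_or_nonempty with rfl | ⟨D, hD⟩
  · exact ⟨0, by simp, by simp, by simp, by simp [coverLength]⟩
  obtain ⟨D', hD', hne, hr⟩ : ∃ D' ∈ 𝒟, D' ≠ D ∧ G.Reach K (v D) (v D') := by
    by_contra! hcon
    have h1 := sum_par K (comp K (v D))
    rw [boundary_comp, hpar, Finset.card_empty, Nat.cast_zero] at h1
    simp only [Finset.sum_apply] at h1
    rw [Finset.sum_comm, Finset.sum_eq_single_of_mem D hD] at h1
    · simp [Pi.single_apply, self_mem_comp] at h1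
    · intro D' hD' hne
      refine Finset.sum_eq_zero fun x hx => Pi.single_eq_of_ne ?_ _
      rintro rfl
      exact hcon D' hD' hne (mem_comp.1 hx)
  obtain ⟨Q, hQK, hQr, hQ⟩ := exists_reach_join hr
  have hDs : ∀ {E}, E ∈ 𝒟 → E ⊆ 𝒟.biUnion id := fun h => Finset.subset_biUnion_of_mem id h
  obtain ⟨S, hS, hDS, hSQ, hconn⟩ := exists_barbell (h𝒟 D hD).1 (h𝒟 D' hD').1
    (hdisj D hD D' hD' hne.symm)
    (fun ⟨C, hC, hb⟩ => hno ⟨C, hC.trans (Finset.union_subset (hDs hD) (hDs hD')), hb⟩)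
    (h𝒟 D hD).2 (h𝒟 D' hD').2 hQr
  set 𝒟' := (𝒟.erase D).erase D' with h𝒟'
  have hD'e : D' ∈ 𝒟.erase D := Finset.mem_erase.2 ⟨hne, hD'⟩
  have hsub : 𝒟' ⊆ 𝒟 := (Finset.erase_subset _ _).trans (Finset.erase_subset _ _)
  have hsum : ∀ {M : Type} [AddCommMonoid M] (f : Finset G.E → M),
      ∑ E ∈ 𝒟, f E = f D + (f D' + ∑ E ∈ 𝒟', f E) := by
    intro M _ f
    rw [Finset.add_sum_erase _ _ hD'e, Finset.add_sum_erase _ _ hD]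
  have hlt : 𝒟'.card < 𝒟.card :=
    (Finset.card_erase_lt_of_mem hD'e).trans_le (Finset.card_le_card (Finset.erase_subset _ _))
  obtain ⟨F, hF1, hF2, hF3, hF4⟩ := ih _ hlt 𝒟' (K \ Q) (fun E hE => h𝒟 E (hsub hE))
    (fun E hE E' hE' => hdisj E (hsub hE) E' (hsub hE'))
    (fun ⟨C, hC, hb⟩ => hno ⟨C, hC.trans (Finset.biUnion_subset_biUnion_of_subset_left _ hsub), hb⟩)
    (fun e he => hK e (Finset.sdiff_subset he))
    (by
      rw [par_sdiff hQK, hpar, hQ, hsum]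
      linear_combination vec_add_self (Pi.single (v D) 1 : G.V → ZMod 2) +
        vec_add_self (Pi.single (v D') 1 : G.V → ZMod 2)) rfl
  have hneg : ∀ T ⊆ D ∪ D' ∪ Q, G.negEdges T = G.negEdges (T ∩ (D ∪ D')) := by
    intro T hT
    ext e
    simp only [negEdges, Finset.mem_filter, Finset.mem_inter]
    constructor
    · rintro ⟨he, hn⟩
      refine ⟨⟨he, ?_⟩, hn⟩
      rcases Finset.mem_union.1 (hT he) with h | h
      · exact h
      · rw [hK e (hQK h)] at hn
        simp at hn
    · tauto
  have hdD := hdisj D hD D' hD' hne.symm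
  have hSeven : Even (G.negEdges S).card := by
    rw [hneg S hSQ, Finset.inter_eq_right.2 hDS, card_negEdges_union hdD]
    have h1 := (h𝒟 D hD).1.2
    have h2 := (h𝒟 D' hD').1.2
    rw [Nat.even_add]
    tauto
  have hSin : ∀ A, negIn S A = negIn D A + negIn D' A := by
    intro A
    rw [← negIn_union hdD, negIn, negIn, hneg _ ((within_subset _ _).trans hSQ)]
    congr 2
    ext e
    have := @hDS e
    simp only [within, Finset.mem_inter, Finset.mem_filter]
    tauto
  refine ⟨S ::ₘ F, ?_, ?_, ?_, ?_⟩
  · intro T hT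
    rcases Multiset.mem_cons.1 hT with rfl | hT
    · exact hS
    · exact hF1 T hT
  · intro E hE e he
    by_cases hED : E = D ∨ E = D'
    · refine ⟨S, Multiset.mem_cons_self _ _, hDS (Finset.mem_union.2 ?_)⟩
      rcases hED with rfl | rfl
      · exact Or.inl he
      · exact Or.inr he
    · push Not at hED
      obtain ⟨T, hT, heT⟩ := hF2 E (Finset.mem_erase.2 ⟨hED.2, Finset.mem_erase.2 ⟨hED.1, hE⟩⟩) e he
      exact ⟨T, Multiset.mem_cons_of_mem hT, heT⟩
  · intro A b hA hodd
    by_cases h1 : Even (negIn S A)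
    · rw [hsum, ← add_assoc, ← hSin, Nat.even_add] at hodd
      obtain ⟨T, hT, hb⟩ := hF3 A b hA (by tauto)
      exact ⟨T, Multiset.mem_cons_of_mem hT, hb⟩
    · exact ⟨S, Multiset.mem_cons_self _ _, mem_of_odd_negIn hconn hSeven hA h1⟩
  · rw [coverLength_cons, hsum]
    have h1 := Finset.card_le_card hSQ
    have h2 := (Finset.card_union_le (D ∪ D') Q)
    have h3 := Finset.card_union_le D D'
    have h4 := Finset.card_sdiff_add_card_eq_card hQK
    omega

/-- The positive edges. -/
def posEdges (G : SignedMultigraph) : Finset G.E := Finset.univ.filter fun e => G.neg e = false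

lemma exists_round {Z : Finset G.E} (hZ : par Z = 0)
    (hZA : ∀ A, G.boundary Finset.univ A = ∅ → Even (negIn Z A))
    (hP : ∀ A, G.boundary (posEdges G) A = ∅ → G.boundary Finset.univ A = ∅) :
    ∃ F : Multiset (Finset G.E), (∀ S ∈ F, G.IsSignedCircuit S) ∧ (∀ e ∈ Z, Covers F e) ∧
      (∀ A b, G.boundary Finset.univ A = {b} → ¬ Even (negIn Z A) → Covers F b) ∧
      2 * G.coverLength F ≤ 2 * Z.card + (core (posEdges G)).card +
        2 * (posEdges G \ core (posEdges G)).card := by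
  induction hn : Z.card using Nat.strong_induction_on generalizing Z with
  | _ n ih =>
  subst hn
  by_cases hbal : ∃ C ⊆ Z, G.IsBalancedCircuit C
  · obtain ⟨C, hCZ, hC⟩ := hbal
    have hsplit : ∀ A, negIn Z A = negIn (Z \ C) A + negIn C A := by
      intro A
      rw [← negIn_union Finset.sdiff_disjoint, Finset.sdiff_union_of_subset hCZ]
    have hcard := Finset.card_sdiff_add_card_eq_card hCZ
    have hCpos := hC.1.1.card_pos
    obtain ⟨F, hF1, hF2, hF3, hF4⟩ := ih (Z \ C).card (by omega)
      (by rw [par_sdiff hCZ, hZ, hC.1.par, add_zero]) (by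
        intro A hA
        have h1 := hZA A hA
        have h2 := even_negIn_of_connOn hC.1.2.1 hC.2 (A := A)
          (Finset.subset_empty.1 (hA ▸ boundary_mono (Finset.subset_univ _) A))
        rw [hsplit, Nat.even_add] at h1
        tauto) rfl
    refine ⟨C ::ₘ F, ?_, ?_, ?_, ?_⟩
    · intro T hT
      rcases Multiset.mem_cons.1 hT with rfl | hT
      · exact Or.inl hC
      · exact hF1 T hT
    · intro e he
      by_cases heC : e ∈ C
      · exact ⟨C, Multiset.mem_cons_self _ _, heC⟩
      · obtain ⟨T, hT, heT⟩ := hF2 e (Finset.mem_sdiff.2 ⟨he, heC⟩)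
        exact ⟨T, Multiset.mem_cons_of_mem hT, heT⟩
    · intro A b hA hodd
      by_cases h1 : Even (negIn C A)
      · rw [hsplit, Nat.even_add] at hodd
        obtain ⟨T, hT, hb⟩ := hF3 A b hA (by tauto)
        exact ⟨T, Multiset.mem_cons_of_mem hT, hb⟩
      · exact ⟨C, Multiset.mem_cons_self _ _, mem_of_odd_negIn hC.1.2.1 hC.2 hA h1⟩
    · rw [coverLength_cons]
      omega
  · obtain ⟨𝒟, h1, h2, h3⟩ := exists_circuit_decomposition hZ
    have hunb : ∀ D ∈ 𝒟, G.IsUnbalancedCircuit D := fun D hD => ⟨h1 D hD, fun he =>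
      hbal ⟨D, h3 ▸ Finset.subset_biUnion_of_mem id hD, h1 D hD, he⟩⟩
    rcases Z.eq_empty_or_nonempty with rfl | ⟨e₀, _⟩
    · exact ⟨0, by simp, by simp, by simp [negIn, within, negEdges], by simp [coverLength]⟩
    obtain ⟨x₀, _, -⟩ := exists_ends e₀
    have hv : ∀ D, ∃ x, D ∈ 𝒟 → x ∈ G.support D := by
      intro D
      by_cases hD : D ∈ 𝒟
      · obtain ⟨e, he⟩ := (h1 D hD).1
        obtain ⟨a, b, hab⟩ := exists_ends e
        exact ⟨a, fun _ => mem_support.2 ⟨e, he, mem_ends_left hab⟩⟩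
      · exact ⟨x₀, fun h => absurd h hD⟩
    choose v hv using hv
    have hneg : ∀ A, negIn Z A = ∑ D ∈ 𝒟, negIn D A := by
      intro A
      rw [← h3]
      have : within (𝒟.biUnion id) A = 𝒟.biUnion fun D => within D A := by
        ext e
        simp only [within, Finset.mem_filter, Finset.mem_biUnion, id]
        grind
      rw [negIn, this, negEdges, Finset.filter_biUnion, Finset.card_biUnion]
      · rfl
      · intro D hD D' hD' hne
        exact (h2 D hD D' hD' hne).mono
          ((Finset.filter_subset _ _).trans (within_subset _ _))
          ((Finset.filter_subset _ _).trans (within_subset _ _))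
    obtain ⟨K₀, hK₀, hpar₀⟩ := exists_tjoin (S := posEdges G)
      (∑ D ∈ 𝒟, Pi.single (v D) 1 : G.V → ZMod 2) (by
        intro A hA
        have hA := hP A hA
        have h4 : ((negIn Z A : ℕ) : ZMod 2) = 0 :=
          (ZMod.natCast_eq_zero_iff_even).2 (hZA A hA)
        simp only [Finset.sum_apply]
        rw [Finset.sum_comm, ← h4, hneg, Nat.cast_sum]
        refine Finset.sum_congr rfl fun D hD => ?_
        have hw := within_eq_of_connOn (h1 D hD).2.1 (A := A)
          (Finset.subset_empty.1 (hA ▸ boundary_mono (Finset.subset_univ _) A)) (hv D hD)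
        simp only [Pi.single_apply, Finset.sum_ite_eq']
        rw [negIn]
        split_ifs with hvA
        · rw [hw.1 hvA]
          exact ((ZMod.natCast_eq_one_iff_odd).2 (Nat.not_even_iff_odd.1 (hunb D hD).2)).symm
        · simp [hw.2 hvA, negEdges])
    obtain ⟨K, hKP, hKpar, hKcard⟩ := exists_small_join hK₀
    obtain ⟨F, hF1, hF2, hF3, hF4⟩ := exists_pairing 𝒟 v K (fun D hD => ⟨hunb D hD, hv D hD⟩) h2
      (by rwa [h3]) (fun e he => (Finset.mem_filter.1 (hKP he)).2) (by rw [hKpar, hpar₀])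
    have hcard : Z.card = ∑ D ∈ 𝒟, D.card := by
      rw [← h3, Finset.card_biUnion]
      · rfl
      · exact fun D hD D' hD' hne => h2 D hD D' hD' hne
    refine ⟨F, hF1, ?_, ?_, by omega⟩
    · intro e he
      rw [← h3, Finset.mem_biUnion] at he
      obtain ⟨D, hD, he⟩ := he
      exact hF2 D hD e he
    · intro A b hA hodd
      exact hF3 A b hA (by rwa [← hneg])

lemma exists_laminar_split {α : Type*} {N : Finset α} (hN : 2 ≤ N.card)
    {𝓛 : Finset α → Prop} (h𝓛 : ∀ X Y, 𝓛 X → 𝓛 Y → X ⊆ Y ∨ Y ⊆ X ∨ Disjoint X Y) :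
    ∃ X ⊆ N, X.Nonempty ∧ (N \ X).Nonempty ∧
      ∀ L, 𝓛 L → L ⊂ N → L ⊆ X ∨ L ⊆ N \ X := by
  by_cases hex : ∃ L, 𝓛 L ∧ L ⊂ N ∧ L.Nonempty
  · obtain ⟨X, hX, hmax⟩ := Finset.exists_max_image
      (N.powerset.filter fun L => 𝓛 L ∧ L ⊂ N ∧ L.Nonempty) Finset.card (by
        obtain ⟨L, h1, h2, h3⟩ := hex
        exact ⟨L, Finset.mem_filter.2 ⟨Finset.mem_powerset.2 h2.1, h1, h2, h3⟩⟩)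
    obtain ⟨-, h1, h2, h3⟩ := Finset.mem_filter.1 hX
    refine ⟨X, h2.1, h3, Finset.sdiff_nonempty.2 h2.2, fun L hL hLN => ?_⟩
    rcases h𝓛 X L h1 hL with h | h | h
    · have := hmax L (Finset.mem_filter.2 ⟨Finset.mem_powerset.2 hLN.1, hL, hLN, h3.mono h⟩)
      exact Or.inl (Finset.eq_of_subset_of_card_le h this).ge
    · exact Or.inl h
    · exact Or.inr (Finset.subset_sdiff.2 ⟨hLN.1, h.symm⟩)
  · obtain ⟨x, hx⟩ := Finset.card_pos.1 (by omega : 0 < N.card)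
    refine ⟨{x}, by simpa using hx, by simp, ?_, fun L hL hLN => Or.inl ?_⟩
    · rw [← Finset.card_pos, Finset.card_sdiff_of_subset (by simpa using hx)]
      simp
      omega
    · rw [Finset.not_nonempty_iff_eq_empty.1 fun h => hex ⟨L, hL, hLN, h⟩]
      simp

lemma exists_laminar_labels {α : Type*} {N : Finset α} (hN : N.Nonempty)
    {𝓛 : Finset α → Prop} (h𝓛 : ∀ X Y, 𝓛 X → 𝓛 Y → X ⊆ Y ∨ Y ⊆ X ∨ Disjoint X Y)
    {a : ZMod 2 × ZMod 2} (ha : a ≠ 0) :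
    ∃ ℓ : α → ZMod 2 × ZMod 2, (∀ x ∈ N, ℓ x ≠ 0) ∧ ∑ x ∈ N, ℓ x = a ∧
      ∀ L, 𝓛 L → L ⊆ N → L.Nonempty → ∑ x ∈ L, ℓ x ≠ 0 := by
  induction hn : N.card using Nat.strong_induction_on generalizing N a with
  | _ n ih =>
  subst hn
  rcases (Nat.succ_le_of_lt hN.card_pos).eq_or_lt with h1 | h1
  · obtain ⟨x, rfl⟩ := Finset.card_eq_one.1 h1.symm
    refine ⟨fun _ => a, fun _ _ => ha, by simp, fun L _ hL hne => ?_⟩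
    rw [(Finset.subset_singleton_iff.1 hL).resolve_left hne.ne_empty]
    simpa using ha
  obtain ⟨X, hXN, hX, hY, hsplit⟩ := exists_laminar_split h1 h𝓛
  obtain ⟨b, c, hb, hc, rfl⟩ : ∃ b c : ZMod 2 × ZMod 2, b ≠ 0 ∧ c ≠ 0 ∧ b + c = a := by
    revert a; decide
  have hcard := Finset.card_sdiff_add_card_eq_card hXN
  have hXp := hX.card_pos
  have hYp := hY.card_pos
  obtain ⟨f, hf1, hf2, hf3⟩ := ih X.card (by omega) hX hb rfl
  obtain ⟨g, hg1, hg2, hg3⟩ := ih (N \ X).card (by omega) hY hc rfl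
  have hfX : ∀ L ⊆ X, ∑ x ∈ L, (if x ∈ X then f x else g x) = ∑ x ∈ L, f x := fun L hL =>
    Finset.sum_congr rfl fun x hx => if_pos (hL hx)
  have hgX : ∀ L ⊆ N \ X, ∑ x ∈ L, (if x ∈ X then f x else g x) = ∑ x ∈ L, g x := fun L hL =>
    Finset.sum_congr rfl fun x hx => if_neg (Finset.mem_sdiff.1 (hL hx)).2
  have htot : ∑ x ∈ N, (if x ∈ X then f x else g x) = b + c := by
    rw [← Finset.sum_sdiff hXN, hfX X subset_rfl, hgX _ subset_rfl, hf2, hg2, add_comm]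
  refine ⟨fun x => if x ∈ X then f x else g x, fun x hx => ?_, htot, fun L hL hLN hne => ?_⟩
  · by_cases hxX : x ∈ X
    · simpa [hxX] using hf1 x hxX
    · simpa [hxX] using hg1 x (Finset.mem_sdiff.2 ⟨hx, hxX⟩)
  · rcases hLN.eq_or_ssubset with rfl | hss
    · rw [htot]; exact ha
    · rcases hsplit L hL hss with h | h
      · rw [hfX L h]; exact hf3 L hL h hne
      · rw [hgX L h]; exact hg3 L hL h hne

/-- Nonzero labels of total zero whose sums over the proper members of a laminar family
are nonzero. -/
lemma exists_laminar_labels_zero {α : Type*} {N : Finset α} (hN : 2 ≤ N.card)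
    {𝓛 : Finset α → Prop} (h𝓛 : ∀ X Y, 𝓛 X → 𝓛 Y → X ⊆ Y ∨ Y ⊆ X ∨ Disjoint X Y) :
    ∃ ℓ : α → ZMod 2 × ZMod 2, (∀ x ∈ N, ℓ x ≠ 0) ∧ ∑ x ∈ N, ℓ x = 0 ∧
      (∀ L, 𝓛 L → L ⊂ N → L.Nonempty → ∑ x ∈ L, ℓ x ≠ 0) ∧
      (N.filter fun x => (ℓ x).1 ≠ 0).card + (N.filter fun x => (ℓ x).2 ≠ 0).card + 4 ≤
        3 * N.card := by
  obtain ⟨X, hXN, hX, hY, hsplit⟩ := exists_laminar_split hN h𝓛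
  have ha : ((1, 0) : ZMod 2 × ZMod 2) ≠ 0 := by decide
  obtain ⟨f, hf1, hf2, hf3⟩ := exists_laminar_labels hX h𝓛 ha
  obtain ⟨g, hg1, hg2, hg3⟩ := exists_laminar_labels hY h𝓛 ha
  have hfX : ∀ L ⊆ X, ∑ x ∈ L, (if x ∈ X then f x else g x) = ∑ x ∈ L, f x := fun L hL =>
    Finset.sum_congr rfl fun x hx => if_pos (hL hx)
  have hgX : ∀ L ⊆ N \ X, ∑ x ∈ L, (if x ∈ X then f x else g x) = ∑ x ∈ L, g x := fun L hL =>
    Finset.sum_congr rfl fun x hx => if_neg (Finset.mem_sdiff.1 (hL hx)).2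
  have htot : ∑ x ∈ N, (if x ∈ X then f x else g x) = 0 := by
    rw [← Finset.sum_sdiff hXN, hfX X subset_rfl, hgX _ subset_rfl, hf2, hg2]
    decide
  refine ⟨fun x => if x ∈ X then f x else g x, fun x hx => ?_, htot, fun L hL hss hne => ?_, ?_⟩
  · by_cases hxX : x ∈ X
    · simpa [hxX] using hf1 x hxX
    · simpa [hxX] using hg1 x (Finset.mem_sdiff.2 ⟨hx, hxX⟩)
  · rcases hsplit L hL hss with h | h
    · rw [hfX L h]; exact hf3 L hL h hne
    · rw [hgX L h]; exact hg3 L hL h hne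
  · set ℓ : α → ZMod 2 × ZMod 2 := fun x => if x ∈ X then f x else g x with hℓ
    have hle1 := Finset.card_filter_le N fun x => (ℓ x).1 ≠ 0
    have hle2 := Finset.card_filter_le N fun x => (ℓ x).2 ≠ 0
    have hev : ∀ k : α → ZMod 2, ∑ x ∈ N, k x = 0 → Even (N.filter fun x => k x ≠ 0).card := by
      intro k hk
      have key : ∀ y : ZMod 2, ((if y ≠ 0 then 1 else 0 : ℕ) : ZMod 2) = y := by decide
      rw [← ZMod.natCast_eq_zero_iff_even, Finset.card_filter, Nat.cast_sum]
      exact (Finset.sum_congr rfl fun x _ => key (k x)).trans hk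
    have he1 := hev (fun x => (ℓ x).1) (by rw [← Prod.fst_sum, htot]; rfl)
    have he2 := hev (fun x => (ℓ x).2) (by rw [← Prod.snd_sum, htot]; rfl)
    rcases Nat.lt_or_ge 2 N.card with h | h
    · grind
    · have hcard := Finset.card_sdiff_add_card_eq_card hXN
      have hXp := hX.card_pos
      have hYp := hY.card_pos
      obtain ⟨x, hx⟩ := Finset.card_eq_one.1 (by omega : X.card = 1)
      obtain ⟨y, hy⟩ := Finset.card_eq_one.1 (by omega : (N \ X).card = 1)
      have h0 : (N.filter fun x => (ℓ x).2 ≠ 0) = ∅ := by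
        refine Finset.filter_eq_empty_iff.2 fun z hz => not_not.2 ?_
        by_cases hzX : z ∈ X
        · rw [hx, Finset.mem_singleton] at hzX
          subst hzX
          simp only [hx, Finset.sum_singleton] at hf2
          simp [hℓ, hx, hf2]
        · have := Finset.mem_sdiff.2 ⟨hz, hzX⟩
          rw [hy, Finset.mem_singleton] at this
          subst this
          simp only [hy, Finset.sum_singleton] at hg2
          simp [hℓ, hzX, hg2]
      rw [h0, Finset.card_empty]
      omega

/-- The negative edges with both ends in `A`. -/
abbrev negSet (A : Finset G.V) : Finset G.E := G.negEdges (within Finset.univ A)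

lemma mem_negSet {A : Finset G.V} {e : G.E} {a b : G.V} (h : G.ends e = s(a, b)) :
    e ∈ negSet A ↔ G.neg e = true ∧ a ∈ A ∧ b ∈ A := by
  simp only [negSet, negEdges, Finset.mem_filter, mem_within h, Finset.mem_univ, true_and]
  tauto

lemma negSet_mono {A B : Finset G.V} (h : A ⊆ B) : negSet A ⊆ negSet (G := G) B := by
  intro e
  obtain ⟨a, b, he⟩ := exists_ends e
  rw [mem_negSet he, mem_negSet he]
  exact fun h' => ⟨h'.1, h h'.2.1, h h'.2.2⟩

lemma boundary_nonempty {r : G.V} {X : Finset G.V} (hX : X ⊆ comp Finset.univ r) (hr : r ∉ X)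
    (hne : X.Nonempty) : ∃ e a b, G.ends e = s(a, b) ∧ ¬ (a ∈ X ↔ b ∈ X) := by
  obtain ⟨x, hx⟩ := hne
  have : G.boundary Finset.univ X ≠ ∅ := fun h =>
    hr ((Reach.mem_iff h (mem_comp.1 (hX hx))).2 hx)
  obtain ⟨e, he⟩ := Finset.nonempty_iff_ne_empty.2 this
  obtain ⟨a, b, h⟩ := exists_ends e
  exact ⟨e, a, b, h, ((mem_boundary h).1 he).2⟩

lemma not_iff_cases {a b : Prop} (h : ¬ (a ↔ b)) : (a ∧ ¬ b) ∨ (¬ a ∧ b) := by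
  tauto

lemma cut_parity_false₁ {a b c d : Prop} (h1 : ¬ (a ↔ b)) (h2 : ¬ (c ↔ d))
    (c1 : ¬ (a ∧ ¬ c ↔ b ∧ ¬ d)) (c3 : ¬ (a ∧ c ↔ b ∧ d)) : False := by
  tauto

lemma cut_parity_false₂ {a b c d a' b' c' d' : Prop} (h1 : ¬ (a ↔ b)) (h2 : ¬ (c' ↔ d'))
    (h3 : c ↔ d) (h4 : a' ↔ b')
    (c1 : ¬ (a ∧ ¬ c ↔ b ∧ ¬ d) ∨ ¬ (a' ∧ ¬ c' ↔ b' ∧ ¬ d'))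
    (c2 : ¬ (c ∧ ¬ a ↔ d ∧ ¬ b) ∨ ¬ (c' ∧ ¬ a' ↔ d' ∧ ¬ b'))
    (c3 : ¬ (a ∧ c ↔ b ∧ d) ∨ ¬ (a' ∧ c' ↔ b' ∧ d'))
    (c4 : ¬ (a ∨ c ↔ b ∨ d) ∨ ¬ (a' ∨ c' ↔ b' ∨ d')) : False := by
  have h5 := not_iff_cases h1
  have h6 := not_iff_cases h2
  have h7 := iff_iff_and_or_not_and_not.1 h3
  have h8 := iff_iff_and_or_not_and_not.1 h4
  clear h1 h2 h3 h4
  rcases h5 with ⟨h5, h5'⟩ | ⟨h5, h5'⟩ <;> rcases h6 with ⟨h6, h6'⟩ | ⟨h6, h6'⟩ <;>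
    rcases h7 with ⟨h7, h7'⟩ | ⟨h7, h7'⟩ <;> rcases h8 with ⟨h8, h8'⟩ | ⟨h8, h8'⟩ <;>
    simp_all

lemma laminar_of_bridges {r : G.V} {A A' : Finset G.V} {b b' : G.E}
    (hA : A ⊆ comp Finset.univ r) (hA' : A' ⊆ comp Finset.univ r) (hr : r ∉ A) (hr' : r ∉ A')
    (hb : G.boundary Finset.univ A = {b}) (hb' : G.boundary Finset.univ A' = {b'}) :
    A ⊆ A' ∨ A' ⊆ A ∨ Disjoint A A' := by
  by_contra! hcon
  obtain ⟨h1, h2, h3⟩ := hcon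
  rw [Finset.not_subset] at h1 h2
  rw [Finset.not_disjoint_iff] at h3
  obtain ⟨x, hx, hx'⟩ := h1
  obtain ⟨y, hy, hy'⟩ := h2
  obtain ⟨z, hz, hz'⟩ := h3
  have key : ∀ e a c, G.ends e = s(a, c) → (¬ (a ∈ A ↔ c ∈ A) ↔ e = b) := by
    intro e a c h
    rw [← Finset.mem_singleton, ← hb, mem_boundary h]
    simp
  have key' : ∀ e a c, G.ends e = s(a, c) → (¬ (a ∈ A' ↔ c ∈ A') ↔ e = b') := by
    intro e a c h
    rw [← Finset.mem_singleton, ← hb', mem_boundary h]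
    simp
  obtain ⟨p, q, hpq⟩ := exists_ends b
  obtain ⟨p', q', hpq'⟩ := exists_ends b'
  have cut : ∀ X : Finset G.V, X ⊆ comp Finset.univ r → r ∉ X → X.Nonempty →
      (∀ u w, (u ∈ A ↔ w ∈ A) → (u ∈ A' ↔ w ∈ A') → (u ∈ X ↔ w ∈ X)) →
      ¬ (p ∈ X ↔ q ∈ X) ∨ ¬ (p' ∈ X ↔ q' ∈ X) := by
    intro X hX hrX hne hXA
    obtain ⟨e, a, c, h, hac⟩ := boundary_nonempty hX hrX hne
    have : e = b ∨ e = b' := by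
      by_contra! h0
      exact hac (hXA a c (not_not.1 fun h' => h0.1 ((key e a c h).1 h'))
        (not_not.1 fun h' => h0.2 ((key' e a c h).1 h')))
    rcases this with rfl | rfl
    · left
      rw [h, Sym2.eq_iff] at hpq
      rcases hpq with ⟨rfl, rfl⟩ | ⟨rfl, rfl⟩
      · exact hac
      · exact fun h => hac h.symm
    · right
      rw [h, Sym2.eq_iff] at hpq'
      rcases hpq' with ⟨rfl, rfl⟩ | ⟨rfl, rfl⟩
      · exact hac
      · exact fun h => hac h.symm
  have c1 := cut (A \ A') (Finset.sdiff_subset.trans hA) (by simp [hr])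
    ⟨x, by simp [hx, hx']⟩ (fun u w h h' => by simp only [Finset.mem_sdiff, h, h'])
  have c2 := cut (A' \ A) (Finset.sdiff_subset.trans hA') (by simp [hr'])
    ⟨y, by simp [hy, hy']⟩ (fun u w h h' => by simp only [Finset.mem_sdiff, h, h'])
  have c3 := cut (A ∩ A') (Finset.inter_subset_left.trans hA) (by simp [hr])
    ⟨z, by simp [hz, hz']⟩ (fun u w h h' => by simp only [Finset.mem_inter, h, h'])
  have c4 := cut (A ∪ A') (Finset.union_subset hA hA') (by simp [hr, hr'])
    ⟨z, by simp [hz]⟩ (fun u w h h' => by simp only [Finset.mem_union, h, h'])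
  have k1 := (key b p q hpq).2 rfl
  have k2 := (key' b' p' q' hpq').2 rfl
  have k3 := key b' p' q' hpq'
  have k4 := key' b p q hpq
  simp only [Finset.mem_sdiff, Finset.mem_inter, Finset.mem_union] at c1 c2 c3 c4
  by_cases hbb : b = b'
  · subst hbb
    rw [hpq, Sym2.eq_iff] at hpq'
    refine cut_parity_false₁ k1 (k4.2 rfl) ?_ ?_
    · rcases hpq' with ⟨rfl, rfl⟩ | ⟨rfl, rfl⟩
      · exact c1.elim id id
      · exact c1.elim id fun h h' => h h'.symm
    · rcases hpq' with ⟨rfl, rfl⟩ | ⟨rfl, rfl⟩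
      · exact c3.elim id id
      · exact c3.elim id fun h h' => h h'.symm
  · exact cut_parity_false₂ k1 k2 (not_not.1 fun h => hbb (k4.1 h))
      (not_not.1 fun h => hbb (k3.1 h).symm) c1 c2 c3 c4

lemma ConnOn.union {S T : Finset G.E} (hS : G.ConnOn S) (hT : G.ConnOn T) {x : G.V}
    (hxS : x ∈ G.support S) (hxT : x ∈ G.support T) : G.ConnOn (S ∪ T) := by
  refine connOn_of_reach x fun w hw => ?_
  rw [support_union, Finset.mem_union] at hw
  exact hw.elim (fun hw => (hS x hxS w hw).mono Finset.subset_union_left)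
    fun hw => (hT x hxT w hw).mono Finset.subset_union_right

lemma IsSignedCircuit.connOn {S : Finset G.E} (h : G.IsSignedCircuit S) : G.ConnOn S := by
  rcases h with h | ⟨C, C', h1, h2, -, h4, rfl⟩ | ⟨C, C', P, u, v, h1, h2, -, h3, h4, h5, -, -, rfl⟩
  · exact h.1.2.1
  · obtain ⟨x, hx⟩ := Finset.card_pos.1 (h4 ▸ Nat.one_pos)
    rw [Finset.mem_inter] at hx
    exact h1.1.2.1.union h2.1.2.1 hx.1 hx.2
  · have hu : u ∈ G.support P ∩ G.support C := h4 ▸ Finset.mem_singleton_self u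
    have hv : v ∈ G.support P ∩ G.support C' := h5 ▸ Finset.mem_singleton_self v
    rw [Finset.mem_inter] at hu hv
    rw [Finset.union_assoc, Finset.union_comm C' P]
    refine h1.1.2.1.union (h3.2.1.union h2.1.2.1 hv.1 hv.2) hu.2 ?_
    rw [support_union]
    exact Finset.mem_union_left _ hu.1

lemma IsUnbalancedCircuit.exists_neg {C : Finset G.E} (h : G.IsUnbalancedCircuit C) :
    (G.negEdges C).Nonempty := by
  rw [Finset.nonempty_iff_ne_empty]
  intro h0
  exact h.2 (by simp [h0])

lemma IsSignedCircuit.two_le {S : Finset G.E} (h : G.IsSignedCircuit S)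
    (hne : (G.negEdges S).Nonempty) : 2 ≤ (G.negEdges S).card := by
  have aux : ∀ C C' : Finset G.E, G.IsUnbalancedCircuit C → G.IsUnbalancedCircuit C' →
      Disjoint C C' → C ∪ C' ⊆ S → 2 ≤ (G.negEdges S).card := by
    intro C C' h1 h2 hd hs
    have h3 := Finset.card_le_card (Finset.filter_subset_filter (fun e => G.neg e = true) hs)
    have h4 := card_negEdges_union hd
    have h5 := h1.exists_neg.card_pos
    have h6 := h2.exists_neg.card_pos
    simp only [negEdges] at *
    omega
  rcases h with h | ⟨C, C', h1, h2, h3, -, h5⟩ | ⟨C, C', P, u, v, h1, h2, h3, -, -, -, -, -, h5⟩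
  · have h1 := h.2
    have h2 := hne.card_pos
    rcases h1 with ⟨k, hk⟩
    omega
  · exact aux C C' h1 h2 h3 h5.ge
  · refine aux C C' h1 h2 (Finset.disjoint_left.2 fun e he he' => ?_)
      (h5 ▸ Finset.subset_union_left)
    obtain ⟨a, b, hab⟩ := exists_ends e
    exact Finset.disjoint_left.1 h3 (mem_support.2 ⟨e, he, mem_ends_left hab⟩)
      (mem_support.2 ⟨e, he', mem_ends_left hab⟩)

lemma two_le_card_negSet_comp (hG : G.SBridgeless) {r : G.V}
    (hne : (negSet (comp (G := G) Finset.univ r)).Nonempty) :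
    2 ≤ (negSet (comp (G := G) Finset.univ r)).card := by
  obtain ⟨e, he⟩ := hne
  obtain ⟨a, b, hab⟩ := exists_ends e
  rw [mem_negSet hab] at he
  obtain ⟨S, hS, heS⟩ := hG e
  have h0 : G.boundary S (comp Finset.univ r) = ∅ :=
    Finset.subset_empty.1 ((boundary_mono (Finset.subset_univ S) _).trans (boundary_comp _ r).le)
  have h1 := (within_eq_of_connOn hS.connOn h0 (mem_support.2 ⟨e, heS, mem_ends_left hab⟩)).1 he.2.1
  refine (hS.two_le ⟨e, Finset.mem_filter.2 ⟨heS, he.1⟩⟩).trans (Finset.card_le_card ?_)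
  rw [← h1]
  exact Finset.filter_subset_filter _ (Finset.filter_subset_filter _ (Finset.subset_univ S))

/-- In an s-bridgeless graph both sides of a bridge contain negative edges. -/
lemma negSet_nonempty_of_bridge (hG : G.SBridgeless) {r : G.V} {A : Finset G.V} {b : G.E}
    (hA : A ⊆ comp Finset.univ r) (hb : G.boundary Finset.univ A = {b}) :
    (negSet A).Nonempty ∧ (negSet (comp Finset.univ r \ A)).Nonempty := by
  obtain ⟨S, hS, hbS⟩ := hG b
  have hbA : b ∈ G.boundary Finset.univ A := hb ▸ Finset.mem_singleton_self b
  have hcut : ∀ T, b ∉ T → G.boundary T A = ∅ := fun T hT =>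
    Finset.eq_empty_of_forall_notMem fun e he => by
      have := boundary_mono (Finset.subset_univ T) A he
      rw [hb, Finset.mem_singleton] at this
      exact hT (this ▸ boundary_subset _ _ he)
  have hcut' : ∀ T, b ∈ T → G.boundary T A = {b} := fun T hT =>
    ((boundary_mono (Finset.subset_univ T) A).trans hb.le).antisymm
      (Finset.singleton_subset_iff.2 (mem_boundary_of_subset hbA hT))
  have hcirc : ∀ C, G.IsCircuit C → b ∉ C := fun C hC h =>
    boundary_ne_singleton hC.par A b (hcut' C h)
  rcases hS with h | ⟨C, C', h1, h2, -, -, rfl⟩ | ⟨C, C', P, u, v, h1, h2, -, h3, h4, h5, -, -, rfl⟩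
  · exact absurd hbS (hcirc _ h.1)
  · rcases Finset.mem_union.1 hbS with h | h
    · exact absurd h (hcirc _ h1.1)
    · exact absurd h (hcirc _ h2.1)
  have hbP : b ∈ P := by
    rcases Finset.mem_union.1 hbS with h | h
    · rcases Finset.mem_union.1 h with h | h
      · exact absurd h (hcirc _ h1.1)
      · exact absurd h (hcirc _ h2.1)
    · exact h
  have hu : u ∈ G.support P ∩ G.support C := h4 ▸ Finset.mem_singleton_self u
  have hv : v ∈ G.support P ∩ G.support C' := h5 ▸ Finset.mem_singleton_self v
  rw [Finset.mem_inter] at hu hv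
  have huv : ¬ (u ∈ A ↔ v ∈ A) := by
    have h := sum_par P A
    rw [hcut' P hbP, h3.par] at h
    simp only [Pi.add_apply, Finset.sum_add_distrib, Pi.single_apply, Finset.sum_ite_eq'] at h
    by_cases h1 : u ∈ A <;> by_cases h2 : v ∈ A <;> simp_all
  have hside : ∀ D w, G.IsUnbalancedCircuit D → w ∈ G.support D → w ∈ A → (negSet A).Nonempty := by
    intro D w hD hw hwA
    obtain ⟨e, he⟩ := hD.exists_neg
    rw [← (within_eq_of_connOn hD.1.2.1 (hcut D (hcirc D hD.1)) hw).1 hwA] at he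
    exact ⟨e, Finset.filter_subset_filter _
      (Finset.filter_subset_filter _ (Finset.subset_univ D)) he⟩
  have hside' : ∀ D w, G.IsUnbalancedCircuit D → w ∈ G.support D → w ∉ A →
      w ∈ comp Finset.univ r → (negSet (comp Finset.univ r \ A)).Nonempty := by
    intro D w hD hw hwA hwr
    obtain ⟨e, he⟩ := hD.exists_neg
    have h0 : G.boundary D (comp Finset.univ r) = ∅ :=
      Finset.subset_empty.1 ((boundary_mono (Finset.subset_univ D) _).trans (boundary_comp _ r).le)
    obtain ⟨x, y, hxy⟩ := exists_ends e
    obtain ⟨heD, hen⟩ := Finset.mem_filter.1 he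
    have hx : G.Reach D w x := hD.1.2.1 w hw x (mem_support.2 ⟨e, heD, mem_ends_left hxy⟩)
    have hy : G.Reach D w y := hD.1.2.1 w hw y (mem_support.2 ⟨e, heD, mem_ends_right hxy⟩)
    have hD0 := hcut D (hcirc D hD.1)
    refine ⟨e, (mem_negSet hxy).2 ⟨hen, ?_, ?_⟩⟩ <;> rw [Finset.mem_sdiff]
    · exact ⟨(hx.mem_iff h0).1 hwr, fun h => hwA ((hx.mem_iff hD0).2 h)⟩
    · exact ⟨(hy.mem_iff h0).1 hwr, fun h => hwA ((hy.mem_iff hD0).2 h)⟩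
  have huvr : u ∈ comp Finset.univ r ↔ v ∈ comp Finset.univ r :=
    Reach.mem_iff (boundary_comp _ r) ((h3.2.1 u hu.1 v hv.1).mono (Finset.subset_univ P))
  by_cases huA : u ∈ A
  · have hvA : v ∉ A := fun h => huv ⟨fun _ => h, fun _ => huA⟩
    exact ⟨hside C u h1 hu.2 huA, hside' C' v h2 hv.2 hvA (huvr.1 (hA huA))⟩
  · have hvA : v ∈ A := by tauto
    exact ⟨hside C' v h2 hv.2 hvA, hside' C u h1 hu.2 huA (huvr.2 (hA hvA))⟩

lemma exists_comp_labels (hG : G.SBridgeless) {r : G.V}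
    (hne : (negSet (comp (G := G) Finset.univ r)).Nonempty) :
    ∃ ℓ : G.E → ZMod 2 × ZMod 2, (∀ e ∈ negSet (comp Finset.univ r), ℓ e ≠ 0) ∧
      ∑ e ∈ negSet (comp Finset.univ r), ℓ e = 0 ∧
      (∀ A b, A ⊆ comp Finset.univ r → G.boundary Finset.univ A = {b} → G.neg b = false →
        ∑ e ∈ negSet A, ℓ e ≠ 0) ∧
      ((negSet (comp Finset.univ r)).filter fun e => (ℓ e).1 ≠ 0).card +
        ((negSet (comp Finset.univ r)).filter fun e => (ℓ e).2 ≠ 0).card + 4 ≤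
          3 * (negSet (comp (G := G) Finset.univ r)).card := by
  set Q := comp (G := G) Finset.univ r with hQ
  obtain ⟨ℓ, h1, h2, h3, h4⟩ := exists_laminar_labels_zero (two_le_card_negSet_comp hG hne)
    (𝓛 := fun X => ∃ A b, A ⊆ Q ∧ r ∉ A ∧ G.boundary Finset.univ A = {b} ∧ X = negSet A) (by
      rintro _ _ ⟨A, b, hA, hr, hb, rfl⟩ ⟨A', b', hA', hr', hb', rfl⟩
      rcases laminar_of_bridges hA hA' hr hr' hb hb' with h | h | h
      · exact Or.inl (negSet_mono h)
      · exact Or.inr (Or.inl (negSet_mono h))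
      · refine Or.inr (Or.inr (Finset.disjoint_left.2 fun e he he' => ?_))
        obtain ⟨x, y, hxy⟩ := exists_ends e
        rw [mem_negSet hxy] at he he'
        exact Finset.disjoint_left.1 h he.2.1 he'.2.1)
  have hmain : ∀ A b, A ⊆ Q → r ∉ A → G.boundary Finset.univ A = {b} →
      ∑ e ∈ negSet A, ℓ e ≠ 0 := by
    intro A b hA hr hb
    obtain ⟨hn1, e, he⟩ := negSet_nonempty_of_bridge hG hA hb
    refine h3 _ ⟨A, b, hA, hr, hb, rfl⟩ ⟨negSet_mono hA, fun hsub => ?_⟩ hn1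
    obtain ⟨x, y, hxy⟩ := exists_ends e
    have h5 := (mem_negSet hxy).1 he
    have h6 := (mem_negSet hxy).1 (hsub (negSet_mono Finset.sdiff_subset he))
    exact (Finset.mem_sdiff.1 h5.2.1).2 h6.2.1
  refine ⟨ℓ, h1, h2, fun A b hA hb hpos => ?_, h4⟩
  by_cases hr : r ∈ A
  · intro h0
    have hQe : ∀ e x y, G.ends e = s(x, y) → (x ∈ Q ↔ y ∈ Q) := fun e x y h =>
      Reach.mem_iff (boundary_comp _ r) (Reach.edge (Finset.mem_univ e) h)
    have hbe : ∀ e x y, G.ends e = s(x, y) → (¬ (x ∈ A ↔ y ∈ A) ↔ e = b) := by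
      intro e x y h
      rw [← Finset.mem_singleton, ← hb, mem_boundary h]
      simp
    have hb' : G.boundary Finset.univ (Q \ A) = {b} := by
      ext e
      obtain ⟨x, y, h⟩ := exists_ends e
      rw [mem_boundary h, Finset.mem_singleton, ← hbe e x y h]
      have h5 := hQe e x y h
      have h6 := @hA x
      have h7 := @hA y
      simp only [Finset.mem_univ, true_and, Finset.mem_sdiff]
      clear * - h5 h6 h7
      tauto
    refine hmain (Q \ A) b Finset.sdiff_subset (by simp [hr]) hb' ?_
    have hsplit : negSet Q = negSet A ∪ negSet (Q \ A) := by
      ext e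
      obtain ⟨x, y, h⟩ := exists_ends e
      rw [Finset.mem_union, mem_negSet h, mem_negSet h, mem_negSet h]
      have h5 := hbe e x y h
      have h6 := @hA x
      have h7 := @hA y
      have h8 : G.neg e = true → e ≠ b := by
        rintro h rfl
        simp [hpos] at h
      simp only [Finset.mem_sdiff]
      by_cases hn : G.neg e = true
      · have h9 := not_not.1 fun h' => h8 hn (h5.1 h')
        clear * - h9 h6 h7 hn
        tauto
      · simp [hn]
    rw [hsplit, Finset.sum_union, h0, zero_add] at h2
    · exact h2
    · refine Finset.disjoint_left.2 fun e he he' => ?_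
      obtain ⟨x, y, hxy⟩ := exists_ends e
      rw [mem_negSet hxy] at he he'
      exact (Finset.mem_sdiff.1 he'.2.1).2 he.2.1
  · exact hmain A b hA hr hb

lemma comp_eq_of_reach {S : Finset G.E} {u v : G.V} (h : G.Reach S u v) :
    comp S u = comp S v := by
  ext w
  rw [mem_comp, mem_comp]
  exact ⟨fun hw => h.symm.trans hw, fun hw => h.trans hw⟩

lemma exists_labels (hG : G.SBridgeless) (hne : (G.negEdges Finset.univ).Nonempty) :
    ∃ ℓ : G.E → ZMod 2 × ZMod 2, (∀ e, G.neg e = true → ℓ e ≠ 0) ∧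
      (∀ A, G.boundary Finset.univ A = ∅ → ∑ e ∈ negSet A, ℓ e = 0) ∧
      (∀ r A b, A ⊆ comp Finset.univ r → G.boundary Finset.univ A = {b} → G.neg b = false →
        ∑ e ∈ negSet A, ℓ e ≠ 0) ∧
      ((G.negEdges Finset.univ).filter fun e => (ℓ e).1 ≠ 0).card +
        ((G.negEdges Finset.univ).filter fun e => (ℓ e).2 ≠ 0).card + 4 ≤
          3 * (G.negEdges Finset.univ).card := by
  have hex : ∀ C : Finset G.V, ∃ ℓ : G.E → ZMod 2 × ZMod 2, (negSet C).Nonempty →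
      (∃ r, C = comp Finset.univ r) → (∀ e ∈ negSet C, ℓ e ≠ 0) ∧ ∑ e ∈ negSet C, ℓ e = 0 ∧
      (∀ A b, A ⊆ C → G.boundary Finset.univ A = {b} → G.neg b = false →
        ∑ e ∈ negSet A, ℓ e ≠ 0) ∧
      ((negSet C).filter fun e => (ℓ e).1 ≠ 0).card +
        ((negSet C).filter fun e => (ℓ e).2 ≠ 0).card + 4 ≤ 3 * (negSet C).card := by
    intro C
    by_cases h : (negSet C).Nonempty ∧ ∃ r, C = comp Finset.univ r
    · obtain ⟨h1, r, rfl⟩ := h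
      obtain ⟨ℓ, hℓ⟩ := exists_comp_labels hG h1
      exact ⟨ℓ, fun _ _ => hℓ⟩
    · exact ⟨0, fun h1 h2 => absurd ⟨h1, h2⟩ h⟩
  choose L hL using hex
  choose p q hpq using fun e : G.E => exists_ends e
  set κ : G.E → Finset G.V := fun e => comp Finset.univ (p e) with hκ
  have hκr : ∀ e r, e ∈ negSet (comp (G := G) Finset.univ r) → κ e = comp Finset.univ r := by
    intro e r he
    exact (comp_eq_of_reach (mem_comp.1 ((mem_negSet (hpq e)).1 he).2.1)).symm
  have hκe : ∀ e, G.neg e = true → e ∈ negSet (κ e) := fun e he =>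
    (mem_negSet (hpq e)).2
      ⟨he, self_mem_comp _ _, mem_comp.2 (Reach.edge (Finset.mem_univ e) (hpq e))⟩
  have hsum : ∀ r, ∀ X ⊆ negSet (comp (G := G) Finset.univ r),
      ∑ e ∈ X, L (κ e) e = ∑ e ∈ X, L (comp Finset.univ r) e := fun r X hX =>
    Finset.sum_congr rfl fun e he => by rw [hκr e r (hX he)]
  refine ⟨fun e => L (κ e) e, fun e he => ?_, fun A hA => ?_, fun r A b hA hb hpos => ?_, ?_⟩
  · exact (hL (κ e) ⟨e, hκe e he⟩ ⟨p e, rfl⟩).1 e (hκe e he)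
  · rw [← Finset.sum_fiberwise_of_maps_to (t := (negSet A).image κ) (g := κ)
      fun e he => Finset.mem_image_of_mem κ he]
    refine Finset.sum_eq_zero fun C hC => ?_
    obtain ⟨e, he, rfl⟩ := Finset.mem_image.1 hC
    have hsub : comp Finset.univ (p e) ⊆ A := fun w hw =>
      (Reach.mem_iff hA (mem_comp.1 hw)).1 ((mem_negSet (hpq e)).1 he).2.1
    have hfib : (negSet A).filter (fun f => κ f = κ e) = negSet (κ e) := by
      ext f
      rw [Finset.mem_filter]
      refine ⟨fun hf => hf.2 ▸ hκe f ((mem_negSet (hpq f)).1 hf.1).1, fun hf =>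
        ⟨negSet_mono hsub hf, hκr f (p e) hf⟩⟩
    rw [hfib, hsum (p e) _ subset_rfl]
    exact (hL (κ e) ⟨e, hκe e ((mem_negSet (hpq e)).1 he).1⟩ ⟨p e, rfl⟩).2.1
  · rw [hsum r _ (negSet_mono hA)]
    have h1 := (negSet_nonempty_of_bridge hG hA hb).1
    exact (hL _ (h1.mono (negSet_mono hA)) ⟨r, rfl⟩).2.2.1 A b hA hb hpos
  · obtain ⟨e₀, he₀⟩ := hne
    have he₀ := (Finset.mem_filter.1 he₀).2
    have hQ := (hL (κ e₀) ⟨e₀, hκe e₀ he₀⟩ ⟨p e₀, rfl⟩).2.2.2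
    have hfil : ∀ (P : ZMod 2 × ZMod 2 → Prop) [DecidablePred P],
        ((G.negEdges Finset.univ).filter fun e => P (L (κ e) e)).card ≤
          ((negSet (κ e₀)).filter fun e => P (L (κ e₀) e)).card +
            (G.negEdges Finset.univ \ negSet (κ e₀)).card := by
      intro P _
      refine (Finset.card_le_card fun e he => ?_).trans (Finset.card_union_le _ _)
      rw [Finset.mem_filter] at he
      rw [Finset.mem_union, Finset.mem_filter, Finset.mem_sdiff]
      by_cases h : e ∈ negSet (κ e₀)
      · have hk : κ e = κ e₀ := hκr e (p e₀) h
        exact Or.inl ⟨h, by rw [← hk]; exact he.2⟩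
      · exact Or.inr ⟨he.1, h⟩
    beta_reduce
    have h1 := hfil fun x => x.1 ≠ 0
    have h2 := hfil fun x => x.2 ≠ 0
    have h3 := Finset.card_sdiff_add_card_eq_card (s := negSet (κ e₀)) (t := G.negEdges Finset.univ)
      (Finset.filter_subset_filter _ (Finset.filter_subset _ _))
    omega

lemma mem_posEdges {e : G.E} : e ∈ posEdges G ↔ G.neg e = false := by simp [posEdges]

lemma mem_negEdges_univ {e : G.E} : e ∈ G.negEdges Finset.univ ↔ G.neg e = true := by
  simp [negEdges]

/-- A set of negative edges, of even size in every component, is covered together with the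
bridges that separate it oddly. -/
lemma exists_round_of_neg {M : Finset G.E} (hM : ∀ e ∈ M, G.neg e = true)
    (hMA : ∀ A, G.boundary Finset.univ A = ∅ → Even (negIn M A))
    (hP : ∀ A, G.boundary (posEdges G) A = ∅ → G.boundary Finset.univ A = ∅) :
    ∃ F : Multiset (Finset G.E), (∀ S ∈ F, G.IsSignedCircuit S) ∧ (∀ e ∈ M, Covers F e) ∧
      (∀ A b, G.boundary Finset.univ A = {b} → ¬ Even (negIn M A) → Covers F b) ∧
      (∀ A b, ∀ e ∈ G.boundary M A, G.boundary Finset.univ A ⊆ {e, b} → Covers F b) ∧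
      2 * G.coverLength F ≤ 2 * M.card + 2 * (core (posEdges G)).card +
        4 * (posEdges G \ core (posEdges G)).card := by
  obtain ⟨J₀, hJ₀, hpar₀⟩ := exists_tjoin (S := posEdges G) (par M) (by
    intro A hA
    rw [sum_par,
      Finset.subset_empty.1 ((boundary_mono (Finset.subset_univ M) A).trans (hP A hA).le)]
    simp)
  obtain ⟨J, hJ, hJpar, hJcard⟩ := exists_small_join hJ₀
  have hd : Disjoint M J := Finset.disjoint_left.2 fun e he he' => by
    have h1 := hM e he
    rw [mem_posEdges.1 (hJ he')] at h1
    simp at h1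
  have hneg : ∀ A, negIn (M ∪ J) A = negIn M A := by
    intro A
    rw [negIn_union hd, Nat.add_eq_left, negIn, Finset.card_eq_zero, negEdges,
      Finset.filter_eq_empty_iff]
    intro e he
    rw [mem_posEdges.1 (hJ (within_subset _ _ he))]
    simp
  have hpar : par (M ∪ J) = 0 := by
    rw [par_union hd, hJpar, hpar₀, vec_add_self]
  obtain ⟨F, h1, h2, h3, h4⟩ := exists_round hpar (fun A hA => hneg A ▸ hMA A hA) hP
  rw [Finset.card_union_of_disjoint hd] at h4
  refine ⟨F, h1, fun e he => h2 e (Finset.mem_union_left _ he),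
    fun A b hA hodd => h3 A b hA (hneg A ▸ hodd), fun A b e he hA => h2 b ?_, by omega⟩
  exact mem_of_even_of_cut (Finset.subset_univ _) hpar hA
    (boundary_mono Finset.subset_union_left A he)

lemma negIn_filter (k : G.E → ZMod 2) (A : Finset G.V) :
    (negIn ((G.negEdges Finset.univ).filter fun e => k e ≠ 0) A : ZMod 2) =
      ∑ e ∈ negSet A, k e := by
  have key : ∀ y : ZMod 2, ((if y ≠ 0 then 1 else 0 : ℕ) : ZMod 2) = y := by decide
  have h : G.negEdges (within ((G.negEdges Finset.univ).filter fun e => k e ≠ 0) A) =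
      (negSet A).filter fun e => k e ≠ 0 := by
    ext e
    simp only [negSet, negEdges, within, Finset.mem_filter, Finset.mem_univ, true_and]
    tauto
  rw [negIn, h, Finset.card_filter, Nat.cast_sum]
  exact Finset.sum_congr rfl fun e _ => key (k e)

/-- The covering bound when the signature has the minimum number of negative edges. -/
lemma exists_cover_of_minimal (hG : G.SBridgeless) (hne : (G.negEdges Finset.univ).Nonempty)
    (hcut : ∀ A, (G.boundary (G.negEdges Finset.univ) A).card ≤
      (G.boundary (posEdges G) A).card) :
    ∃ F : Multiset (Finset G.E), (∀ S ∈ F, G.IsSignedCircuit S) ∧ (∀ e, Covers F e) ∧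
      2 * G.coverLength F + 8 ≤ 9 * (core (posEdges G)).card +
        8 * (posEdges G \ core (posEdges G)).card + 6 * (G.negEdges Finset.univ).card := by
  have huniv : ∀ A, G.boundary Finset.univ A =
      G.boundary (posEdges G) A ∪ G.boundary (G.negEdges Finset.univ) A := by
    intro A
    ext e
    simp only [boundary, Finset.mem_union, Finset.mem_filter, mem_posEdges, mem_negEdges_univ,
      Finset.mem_univ, true_and]
    cases G.neg e <;> simp
  have hP : ∀ A, G.boundary (posEdges G) A = ∅ → G.boundary Finset.univ A = ∅ := by
    intro A hA
    have h := hcut A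
    rw [hA, Finset.card_empty, Nat.le_zero, Finset.card_eq_zero] at h
    rw [huniv, hA, h, Finset.empty_union]
  obtain ⟨ℓ, h1, h2, h3, h4⟩ := exists_labels hG hne
  set N₁ := (G.negEdges Finset.univ).filter fun e => (ℓ e).1 ≠ 0 with hN₁
  set N₂ := (G.negEdges Finset.univ).filter fun e => (ℓ e).2 ≠ 0 with hN₂
  have hs₁ : ∀ A, (negIn N₁ A : ZMod 2) = (∑ e ∈ negSet A, ℓ e).1 := fun A => by
    rw [Prod.fst_sum]; exact negIn_filter (fun e => (ℓ e).1) A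
  have hs₂ : ∀ A, (negIn N₂ A : ZMod 2) = (∑ e ∈ negSet A, ℓ e).2 := fun A => by
    rw [Prod.snd_sum]; exact negIn_filter (fun e => (ℓ e).2) A
  have hN : ∀ e, G.neg e = true → e ∈ N₁ ∨ e ∈ N₂ := by
    intro e he
    by_contra! h
    simp only [hN₁, hN₂, Finset.mem_filter, mem_negEdges_univ, he, true_and, not_not] at h
    exact h1 e he (Prod.ext h.1 h.2)
  obtain ⟨F₁, a1, a2, a3, a4, a5⟩ := exists_round_of_neg (M := N₁)
    (fun e he => mem_negEdges_univ.1 (Finset.mem_filter.1 he).1)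
    (fun A hA => by rw [← ZMod.natCast_eq_zero_iff_even, hs₁, h2 A hA]; rfl) hP
  obtain ⟨F₂, b1, b2, b3, b4, b5⟩ := exists_round_of_neg (M := N₂)
    (fun e he => mem_negEdges_univ.1 (Finset.mem_filter.1 he).1)
    (fun A hA => by rw [← ZMod.natCast_eq_zero_iff_even, hs₂, h2 A hA]; rfl) hP
  obtain ⟨F₃, c1, c2, c3⟩ := exists_cover_of_bridgeless (S := core (posEdges G))
    (fun e he => mem_posEdges.1 (core_subset _ he)) (core_bridgeless _)
  have hcov₁ : ∀ e, Covers F₁ e → Covers (F₁ + F₂ + F₃) e := fun e ⟨S, hS, he⟩ =>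
    ⟨S, by simp [hS], he⟩
  have hcov₂ : ∀ e, Covers F₂ e → Covers (F₁ + F₂ + F₃) e := fun e ⟨S, hS, he⟩ =>
    ⟨S, by simp [hS], he⟩
  have hcov₃ : ∀ e, Covers F₃ e → Covers (F₁ + F₂ + F₃) e := fun e ⟨S, hS, he⟩ =>
    ⟨S, by simp [hS], he⟩
  refine ⟨F₁ + F₂ + F₃, fun S hS => ?_, fun e => ?_, ?_⟩
  · rw [Multiset.mem_add, Multiset.mem_add] at hS
    rcases hS with (hS | hS) | hS
    · exact a1 S hS
    · exact b1 S hS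
    · exact c1 S hS
  · cases hneg : G.neg e
    · have he := mem_posEdges.2 hneg
      by_cases hec : e ∈ core (posEdges G)
      · exact hcov₃ e (c2 e hec)
      obtain ⟨a, b, -, hA⟩ := exists_boundary_of_not_even he
        fun h => hec (Finset.mem_filter.2 ⟨he, h⟩)
      set A := comp ((posEdges G).erase e) a
      have hAsub : A ⊆ comp Finset.univ a := fun w hw =>
        mem_comp.2 ((mem_comp.1 hw).mono (Finset.subset_univ _))
      have hle := hcut A
      rw [hA, Finset.card_singleton] at hle
      rcases Nat.le_one_iff_eq_zero_or_eq_one.1 hle with h0 | h0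
      · rw [Finset.card_eq_zero] at h0
        have hU : G.boundary Finset.univ A = {e} := by rw [huniv, hA, h0, Finset.union_empty]
        have hsum := h3 a A e hAsub hU hneg
        by_cases hodd : Even (negIn N₁ A)
        · refine hcov₂ e (b3 A e hU fun hodd₂ => hsum (Prod.ext ?_ ?_))
          · rw [← hs₁, ZMod.natCast_eq_zero_iff_even.2 hodd]; rfl
          · rw [← hs₂, ZMod.natCast_eq_zero_iff_even.2 hodd₂]; rfl
        · exact hcov₁ e (a3 A e hU hodd)
      · obtain ⟨f, hf⟩ := Finset.card_eq_one.1 h0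
        have hU : G.boundary Finset.univ A ⊆ {f, e} := by
          rw [huniv, hA, hf]
          intro x
          simp only [Finset.mem_union, Finset.mem_singleton, Finset.mem_insert]
          exact Or.symm
        have hfA : f ∈ G.boundary (G.negEdges Finset.univ) A := hf ▸ Finset.mem_singleton_self f
        rcases hN f (mem_negEdges_univ.1 (boundary_subset _ _ hfA)) with hfN | hfN
        · exact hcov₁ e (a4 A e f (mem_boundary_of_subset hfA hfN) hU)
        · exact hcov₂ e (b4 A e f (mem_boundary_of_subset hfA hfN) hU)
    · rcases hN e hneg with h | h
      · exact hcov₁ e (a2 e h)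
      · exact hcov₂ e (b2 e h)
  · rw [coverLength_add, coverLength_add]
    omega

/-- The signed graph obtained from `G` by switching at the vertices of `A`. -/
abbrev switch (G : SignedMultigraph) (A : Finset G.V) : SignedMultigraph where
  V := G.V
  E := G.E
  ends := G.ends
  neg := G.negAfter A

lemma even_negEdges_switch (A : Finset G.V) {S : Finset G.E} (hS : par S = 0) :
    Even ((G.switch A).negEdges S).card ↔ Even (G.negEdges S).card := by
  have h : (G.switch A).negEdges S = G.negEdges S ∆ G.boundary S A := by
    ext e
    simp only [negEdges, boundary, negAfter, Finset.mem_symmDiff, Finset.mem_filter]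
    rcases hn : G.neg e <;> rcases hA : G.crossesB A e <;> simp [hn, hA]
  have h1 := sum_symmDiff_zmod (G.negEdges S) (G.boundary S A) fun _ => 1
  simp only [Finset.sum_const, nsmul_eq_mul, mul_one] at h1
  rw [ZMod.natCast_eq_zero_iff_even.2 (even_boundary hS A), add_zero, ← h] at h1
  rw [← ZMod.natCast_eq_zero_iff_even, ← ZMod.natCast_eq_zero_iff_even]
  exact Eq.congr_left h1

lemma isBalancedCircuit_switch (A : Finset G.V) (S : Finset G.E) :
    (G.switch A).IsBalancedCircuit S ↔ G.IsBalancedCircuit S :=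
  and_congr_right fun h => even_negEdges_switch A (IsCircuit.par (G := G) h)

lemma isUnbalancedCircuit_switch (A : Finset G.V) (S : Finset G.E) :
    (G.switch A).IsUnbalancedCircuit S ↔ G.IsUnbalancedCircuit S :=
  and_congr_right fun h => not_congr (even_negEdges_switch A (IsCircuit.par (G := G) h))

lemma isSignedCircuit_switch (A : Finset G.V) (S : Finset G.E) :
    (G.switch A).IsSignedCircuit S ↔ G.IsSignedCircuit S := by
  refine or_congr (isBalancedCircuit_switch A S) (or_congr ?_ ?_)
  · exact exists_congr fun C => exists_congr fun C' => and_congr (isUnbalancedCircuit_switch A C)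
      (and_congr (isUnbalancedCircuit_switch A C') Iff.rfl)
  · exact exists_congr fun C => exists_congr fun C' => exists_congr fun P => exists_congr fun u =>
      exists_congr fun v => and_congr (isUnbalancedCircuit_switch A C)
        (and_congr (isUnbalancedCircuit_switch A C') Iff.rfl)

lemma crossesB_symmDiff (A B : Finset G.V) (e : G.E) :
    G.crossesB (A ∆ B) e = Bool.xor (G.crossesB A e) (G.crossesB B e) := by
  obtain ⟨a, b, h⟩ := exists_ends e
  rw [crossesB_eq h, crossesB_eq h, crossesB_eq h]
  by_cases h1 : a ∈ A <;> by_cases h2 : b ∈ A <;> by_cases h3 : a ∈ B <;> by_cases h4 : b ∈ B <;>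
    simp [Finset.mem_symmDiff, h1, h2, h3, h4]

lemma negativeness_le (A : Finset G.V) :
    G.negativeness ≤ ((G.switch A).negEdges Finset.univ).card :=
  Nat.sInf_le ⟨A, rfl⟩

lemma exists_negativeness_eq :
    ∃ A, ((G.switch A).negEdges Finset.univ).card = G.negativeness :=
  Nat.sInf_mem (s := { n | ∃ A : Finset G.V,
    (Finset.univ.filter fun e => G.negAfter A e = true).card = n }) ⟨_, ∅, rfl⟩

/-- In a minimum signature every cut has at most as many negative as positive edges. -/
lemma card_boundary_le_of_minimal {A : Finset G.V}
    (hA : ((G.switch A).negEdges Finset.univ).card = G.negativeness) (B : Finset G.V) :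
    ((G.switch A).boundary ((G.switch A).negEdges Finset.univ) B).card ≤
      ((G.switch A).boundary (posEdges (G.switch A)) B).card := by
  have h := negativeness_le (A ∆ B)
  rw [← hA] at h
  have h1 := Finset.card_filter_add_card_filter_not (s := (G.switch A).negEdges Finset.univ)
    fun e => G.crossesB B e = true
  have h2 : (G.switch (A ∆ B)).negEdges Finset.univ =
      ((G.switch A).negEdges Finset.univ).filter (fun e => ¬ G.crossesB B e = true) ∪
        (G.switch A).boundary (posEdges (G.switch A)) B := by
    ext e
    have hc : (G.switch A).crossesB B e = G.crossesB B e := rfl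
    simp only [negEdges, boundary, posEdges, Finset.mem_union, Finset.mem_filter, Finset.mem_univ,
      true_and, negAfter, crossesB_symmDiff, hc]
    rcases hn : G.neg e <;> rcases hA : G.crossesB A e <;> rcases hB : G.crossesB B e <;>
      simp [hn, hA]
  have h3 := Finset.card_union_le
    (((G.switch A).negEdges Finset.univ).filter fun e => ¬ G.crossesB B e = true)
    ((G.switch A).boundary (posEdges (G.switch A)) B)
  rw [← h2] at h3
  have h4 : (G.switch A).boundary ((G.switch A).negEdges Finset.univ) B =
    ((G.switch A).negEdges Finset.univ).filter fun e => G.crossesB B e = true := rfl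
  rw [h4]
  change _ ≤ ((G.switch (A ∆ B)).negEdges Finset.univ).card at h
  have h5 := h.trans h3
  rw [← h1] at h5
  rw [add_comm] at h5
  exact Nat.le_of_add_le_add_left h5

lemma scc_le_of_covers {F : Multiset (Finset G.E)} (hF : ∀ S ∈ F, G.IsSignedCircuit S)
    (hcov : ∀ e, Covers F e) : G.SCC ≤ G.coverLength F := by
  refine Nat.sInf_le ⟨F, ⟨hF, fun e => ?_⟩, rfl⟩
  obtain ⟨S, hS, he⟩ := hcov e
  exact Multiset.card_pos_iff_exists_mem.2 ⟨S, Multiset.mem_filter.2 ⟨hS, he⟩⟩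

lemma card_core_add_card_sdiff_add_card_negEdges :
    (core (posEdges G)).card + (posEdges G \ core (posEdges G)).card +
      (G.negEdges Finset.univ).card = Fintype.card G.E := by
  have h1 := Finset.card_sdiff_add_card_eq_card (core_subset (posEdges G))
  have h2 := Finset.card_filter_add_card_filter_not (s := (Finset.univ : Finset G.E))
    fun e => G.neg e = true
  have h3 : (Finset.univ.filter fun e => ¬ G.neg e = true) = posEdges G :=
    Finset.filter_congr fun e _ => by simp
  rw [h3] at h2
  rw [← Finset.card_univ, ← h2, ← h1]
  simp only [negEdges]
  ring

lemma exists_cover (hG : G.SBridgeless) (hneg : 0 < G.negativeness) :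
    ∃ p q, p + q + G.negativeness = Fintype.card G.E ∧
      2 * G.SCC + 8 ≤ 9 * p + 8 * q + 6 * G.negativeness := by
  obtain ⟨A, hA⟩ := exists_negativeness_eq (G := G)
  have hG' : (G.switch A).SBridgeless := fun e =>
    (hG e).imp fun S hS => ⟨(isSignedCircuit_switch A S).2 hS.1, hS.2⟩
  obtain ⟨F, h1, h2, h3⟩ := exists_cover_of_minimal hG'
    (Finset.card_pos.1 (hA ▸ hneg)) (card_boundary_le_of_minimal hA)
  refine ⟨(core (posEdges (G.switch A))).card,
    (posEdges (G.switch A) \ core (posEdges (G.switch A))).card, ?_, ?_⟩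
  rotate_left
  · rw [hA] at h3
    refine le_trans ?_ h3
    have := scc_le_of_covers (fun S hS => (isSignedCircuit_switch A S).1 (h1 S hS)) h2
    exact Nat.add_le_add_right (Nat.mul_le_mul_left 2 this) 8
  · rw [← hA]
    exact card_core_add_card_sdiff_add_card_negEdges (G := G.switch A)

end SignedMultigraph

/-- Let `G` be an s-bridgeless signed graph with negativeness
`ε_N(G) > 0`. Then `SCC(G) ≤ (14/3)|E| − (5/3)ε_N(G) − 4`. -/
theorem scc_global_bound (G : SignedMultigraph) (hG : G.SBridgeless)
    (hneg : 0 < G.negativeness) :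
    (G.SCC : ℝ) ≤ (14 / 3 : ℝ) * (Fintype.card G.E : ℝ) -
      (5 / 3 : ℝ) * (G.negativeness : ℝ) - 4 := by
  obtain ⟨p, q, h1, h2⟩ := SignedMultigraph.exists_cover hG hneg
  rw [← h1]
  have h3 : (2 * (G.SCC : ℝ) + 8) ≤ 9 * p + 8 * q + 6 * G.negativeness := by exact_mod_cast h2
  have h4 : (0 : ℝ) ≤ p := p.cast_nonneg
  have h5 : (0 : ℝ) ≤ q := q.cast_nonneg
  push_cast
  linarith
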